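/- arXiv:0809.1182 — 5 statements merged into one kernel-verified Lean document; each statement's English description precedes it below -/
import Mathlib

section
/- The set of all complex structures on su(2) ⊕ su(2), viewed as a subset of the space ℝ³⁶ of 6×6 real matrices with the subspace topology, is a closed subset of the open set {(aⁱⱼ) : Σ_{1≤i≤3, 4≤j≤6} (aⁱⱼ)² ≠ 0, and the two triples (a²₃−a³₂, a¹₃−a³₁, a¹₂−a²₁) and (a⁵₆−a⁶₅, a⁴₆−a⁶₄, a⁴₅−a⁵₄) are nonzero} and is homeomorphic to ℝ × (ℝ ∖ {0}) × S² × S². -/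
/-- `R` is a special orthogonal 3×3 matrix. -/
def so3 (R : Matrix (Fin 3) (Fin 3) ℝ) : Prop := R * R.transpose = 1 ∧ R.det = 1

/-- The Lie bracket of su(2) ⊕ su(2) in the basis (J₁⁽¹⁾,J₂⁽¹⁾,J₃⁽¹⁾,J₁⁽²⁾,J₂⁽²⁾,J₃⁽²⁾):
the cross product on each group of three coordinates. -/
def bra6 (x y : Fin 6 → ℝ) : Fin 6 → ℝ :=
  ![x 1 * y 2 - x 2 * y 1, x 2 * y 0 - x 0 * y 2, x 0 * y 1 - x 1 * y 0,
    x 4 * y 5 - x 5 * y 4, x 5 * y 3 - x 3 * y 5, x 3 * y 4 - x 4 * y 3]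

/-- `J` (as a 6×6 matrix) has zero torsion on su(2) ⊕ su(2). -/
def torsion6 (J : Matrix (Fin 6) (Fin 6) ℝ) : Prop :=
  ∀ X Y : Fin 6 → ℝ,
    bra6 (J.mulVec X) (J.mulVec Y) - bra6 X Y
      - J.mulVec (bra6 (J.mulVec X) Y) - J.mulVec (bra6 X (J.mulVec Y)) = 0

/-- `J` is a complex structure on su(2) ⊕ su(2). -/
def isCx6 (J : Matrix (Fin 6) (Fin 6) ℝ) : Prop := J * J = -1 ∧ torsion6 J

/-- The block-diagonal 6×6 matrix diag(A, B), for A, B 3×3. -/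
def diag33 (A B : Matrix (Fin 3) (Fin 3) ℝ) : Matrix (Fin 6) (Fin 6) ℝ :=
  !![A 0 0, A 0 1, A 0 2, 0, 0, 0;
     A 1 0, A 1 1, A 1 2, 0, 0, 0;
     A 2 0, A 2 1, A 2 2, 0, 0, 0;
     0, 0, 0, B 0 0, B 0 1, B 0 2;
     0, 0, 0, B 1 0, B 1 1, B 1 2;
     0, 0, 0, B 2 0, B 2 1, B 2 2]

/-- The set of complex structures on su(2) ⊕ su(2), inside the 6×6 matrices ≅ ℝ³⁶. -/
def X6 : Set (Matrix (Fin 6) (Fin 6) ℝ) := {A | isCx6 A}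

/-- The open set of 6×6 matrices in which `X6` is closed. -/
def U6 : Set (Matrix (Fin 6) (Fin 6) ℝ) :=
  {A | ((A 0 3) ^ 2 + (A 0 4) ^ 2 + (A 0 5) ^ 2 +
        (A 1 3) ^ 2 + (A 1 4) ^ 2 + (A 1 5) ^ 2 +
        (A 2 3) ^ 2 + (A 2 4) ^ 2 + (A 2 5) ^ 2) ≠ 0 ∧
       (A 1 2 - A 2 1, A 0 2 - A 2 0, A 0 1 - A 1 0) ≠ (0, 0, 0) ∧
       (A 4 5 - A 5 4, A 3 5 - A 5 3, A 3 4 - A 4 3) ≠ (0, 0, 0)}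

open Matrix

/-- The matrix of `x ↦ t (w ⬝ x) w + w × x`. -/
def axialMatrix (t : ℝ) (w : Fin 3 → ℝ) : Matrix (Fin 3) (Fin 3) ℝ :=
  !![t * w 0 * w 0, t * w 0 * w 1 - w 2, t * w 0 * w 2 + w 1;
     t * w 1 * w 0 + w 2, t * w 1 * w 1, t * w 1 * w 2 - w 0;
     t * w 2 * w 0 - w 1, t * w 2 * w 1 + w 0, t * w 2 * w 2]

lemma axialMatrix_mulVec (t : ℝ) (w x : Fin 3 → ℝ) :
    axialMatrix t w *ᵥ x = (t * (w ⬝ᵥ x)) • w + w ⨯₃ x := by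
  ext i
  fin_cases i <;>
    simp [axialMatrix, mulVec, dotProduct, Fin.sum_univ_succ, cross_apply] <;> ring

/-- A zero-torsion endomorphism of `ℝ³` with the cross product is axial. -/
lemma exists_eq_axialMatrix (A : Matrix (Fin 3) (Fin 3) ℝ)
    (hA : ∀ x y, (A *ᵥ x) ⨯₃ (A *ᵥ y) - x ⨯₃ y
      - A *ᵥ ((A *ᵥ x) ⨯₃ y) - A *ᵥ (x ⨯₃ (A *ᵥ y)) = 0) :
    ∃ (t : ℝ) (w : Fin 3 → ℝ), w 0 ^ 2 + w 1 ^ 2 + w 2 ^ 2 = 1 ∧ A = axialMatrix t w := by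
  obtain ⟨a, ha⟩ : ∃ a, a = A 0 0 := ⟨_, rfl⟩
  obtain ⟨b, hb⟩ : ∃ b, b = A 1 1 := ⟨_, rfl⟩
  obtain ⟨c, hc⟩ : ∃ c, c = A 2 2 := ⟨_, rfl⟩
  obtain ⟨d, hd⟩ : ∃ d, d = (A 1 2 + A 2 1) / 2 := ⟨_, rfl⟩
  obtain ⟨e, he⟩ : ∃ e, e = (A 0 2 + A 2 0) / 2 := ⟨_, rfl⟩
  obtain ⟨f, hf⟩ : ∃ f, f = (A 0 1 + A 1 0) / 2 := ⟨_, rfl⟩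
  obtain ⟨p, hp⟩ : ∃ p, p = (A 2 1 - A 1 2) / 2 := ⟨_, rfl⟩
  obtain ⟨q, hq⟩ : ∃ q, q = (A 0 2 - A 2 0) / 2 := ⟨_, rfl⟩
  obtain ⟨r, hr⟩ : ∃ r, r = (A 1 0 - A 0 1) / 2 := ⟨_, rfl⟩
  have e1 : A = !![a, f - r, e + q; f + r, b, d - p; e - q, d + p, c] := by
    subst ha hb hc hd he hf hp hq hr
    ext i j
    fin_cases i <;> fin_cases j <;> simp <;> ring
  clear ha hb hc hd he hf hp hq hr
  subst e1
  have h23 := hA ![0, 1, 0] ![0, 0, 1]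
  have h31 := hA ![0, 0, 1] ![1, 0, 0]
  have h12 := hA ![1, 0, 0] ![0, 1, 0]
  clear hA
  simp only [funext_iff, Fin.forall_fin_succ, mulVec, dotProduct, Fin.sum_univ_succ,
    cross_apply, Pi.sub_apply, Pi.zero_apply] at h23 h31 h12
  simp at h23 h31 h12
  obtain ⟨E00, E10, E20⟩ := h23
  obtain ⟨E01, E11, E21⟩ := h31
  obtain ⟨E02, E12, E22⟩ := h12
  obtain ⟨t, ht⟩ : ∃ t, t = a + b + c := ⟨_, rfl⟩
  obtain ⟨s, hs⟩ : ∃ s, s = a * b + b * c + c * a - d ^ 2 - e ^ 2 - f ^ 2 := ⟨_, rfl⟩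
  have v0 : a * p + f * q + e * r = t * p := by
    subst ht; linear_combination (E21 - E12) / 2
  have v1 : f * p + b * q + d * r = t * q := by
    subst ht; linear_combination (E02 - E20) / 2
  have v2 : e * p + d * q + c * r = t * r := by
    subst ht; linear_combination (E10 - E01) / 2
  have htr : -s + 3 * (p ^ 2 + q ^ 2 + r ^ 2) = 3 := by
    subst hs; linear_combination E00 + E11 + E22
  have hw : ∀ x, x = p ∨ x = q ∨ x = r → (s + (p ^ 2 + q ^ 2 + r ^ 2) - 1) * x = 0 := by
    subst ht hs
    rintro x (rfl | rfl | rfl)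
    · linear_combination x * E00 + q * E01 + r * E02 - 2 * (a * v0 + f * v1 + e * v2)
    · linear_combination p * E10 + x * E11 + r * E12 - 2 * (f * v0 + b * v1 + d * v2)
    · linear_combination p * E20 + q * E21 + x * E22 - 2 * (e * v0 + d * v1 + c * v2)
  have hs1 : s + (p ^ 2 + q ^ 2 + r ^ 2) = 1 := by
    by_contra hne
    have hne' : s + (p ^ 2 + q ^ 2 + r ^ 2) - 1 ≠ 0 := fun h => hne (by linarith)
    have hp := (mul_eq_zero.1 (hw p (by simp))).resolve_left hne'
    have hq := (mul_eq_zero.1 (hw q (by simp))).resolve_left hne'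
    have hr := (mul_eq_zero.1 (hw r (by simp))).resolve_left hne'
    subst hp hq hr hs
    have k0 : b * c - d ^ 2 = -1 := by linear_combination E00 / 2 - htr / 2
    have k1 : a * c - e ^ 2 = -1 := by linear_combination E11 / 2 - htr / 2
    have k2 : a * b - f ^ 2 = -1 := by linear_combination E22 / 2 - htr / 2
    have k3 : e * f - a * d = 0 := by linear_combination E12 / 2
    have k4 : d * f - b * e = 0 := by linear_combination E02 / 2
    have k5 : d * e - c * f = 0 := by linear_combination E01 / 2
    have hdet : (a * b * c + 2 * d * e * f - a * d ^ 2 - b * e ^ 2 - c * f ^ 2) ^ 2 =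
        (b * c - d ^ 2) * (a * c - e ^ 2) * (a * b - f ^ 2)
        + 2 * (e * f - a * d) * (d * f - b * e) * (d * e - c * f)
        - (b * c - d ^ 2) * (e * f - a * d) ^ 2 - (a * c - e ^ 2) * (d * f - b * e) ^ 2
        - (a * b - f ^ 2) * (d * e - c * f) ^ 2 := by ring
    rw [k0, k1, k2, k3, k4, k5] at hdet
    nlinarith [sq_nonneg (a * b * c + 2 * d * e * f - a * d ^ 2 - b * e ^ 2 - c * f ^ 2)]
  have hn : p ^ 2 + q ^ 2 + r ^ 2 = 1 := by linarith
  have hs0 : s = 0 := by linarith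
  have hsum : (a - t * p * p) ^ 2 + (b - t * q * q) ^ 2 + (c - t * r * r) ^ 2
      + 2 * (d - t * q * r) ^ 2 + 2 * (e - t * p * r) ^ 2 + 2 * (f - t * p * q) ^ 2 = 0 := by
    rw [hs0] at hs
    linear_combination 2 * hs - (t + a + b + c) * ht - 2 * t * (p * v0 + q * v1 + r * v2)
      + t ^ 2 * (p ^ 2 + q ^ 2 + r ^ 2 - 1) * hn
  have n0 := sq_nonneg (a - t * p * p)
  have n1 := sq_nonneg (b - t * q * q)
  have n2 := sq_nonneg (c - t * r * r)
  have n3 := sq_nonneg (d - t * q * r)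
  have n4 := sq_nonneg (e - t * p * r)
  have n5 := sq_nonneg (f - t * p * q)
  have z0 : a = t * p * p :=
    sub_eq_zero.1 ((pow_eq_zero_iff two_ne_zero).1 (by linarith))
  have z1 : b = t * q * q :=
    sub_eq_zero.1 ((pow_eq_zero_iff two_ne_zero).1 (by linarith))
  have z2 : c = t * r * r :=
    sub_eq_zero.1 ((pow_eq_zero_iff two_ne_zero).1 (by linarith))
  have z3 : d = t * q * r :=
    sub_eq_zero.1 ((pow_eq_zero_iff two_ne_zero).1 (by linarith))
  have z4 : e = t * p * r :=
    sub_eq_zero.1 ((pow_eq_zero_iff two_ne_zero).1 (by linarith))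
  have z5 : f = t * p * q :=
    sub_eq_zero.1 ((pow_eq_zero_iff two_ne_zero).1 (by linarith))
  clear v0 v1 v2 E00 E10 E20 E01 E11 E21 E02 E12 E22 hw hs hsum n0 n1 n2 n3 n4 n5 ht
  refine ⟨t, ![p, q, r], by simpa using hn, ?_⟩
  ext i j
  fin_cases i <;> fin_cases j <;> simp [axialMatrix, z0, z1, z2, z3, z4, z5] <;> ring

/-- An off-diagonal block intertwining two axial matrices, in the way the off-diagonal blocks of a
complex structure do, has rank at most one. -/
lemma mulVec_eq_of_axialMatrix {t t' : ℝ} {w z : Fin 3 → ℝ} {B C : Matrix (Fin 3) (Fin 3) ℝ}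
    (hw : w ⬝ᵥ w = 1) (hz : z ⬝ᵥ z = 1)
    (hC : ∀ x y, (C *ᵥ x) ⨯₃ (C *ᵥ y) =
      C *ᵥ ((axialMatrix t w *ᵥ x) ⨯₃ y + x ⨯₃ (axialMatrix t w *ᵥ y)))
    (hBC : ∀ x, B *ᵥ (C *ᵥ x) = -(x + axialMatrix t w *ᵥ (axialMatrix t w *ᵥ x)))
    (hCB : ∀ x, C *ᵥ (B *ᵥ x) = -(x + axialMatrix t' z *ᵥ (axialMatrix t' z *ᵥ x)))
    (hCA : ∀ x, C *ᵥ (axialMatrix t w *ᵥ x) = -(axialMatrix t' z *ᵥ (C *ᵥ x))) :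
    ∃ d : ℝ, ∀ x, C *ᵥ x = (d * (w ⬝ᵥ x)) • z := by
  have hsq : ∀ (t : ℝ) (w x : Fin 3 → ℝ), w ⬝ᵥ w = 1 →
      x + axialMatrix t w *ᵥ (axialMatrix t w *ᵥ x) = ((1 + t ^ 2) * (w ⬝ᵥ x)) • w := by
    intro t w x hw
    simp only [dotProduct, Fin.sum_univ_succ] at hw
    simp at hw
    ext i
    fin_cases i <;>
      simp [axialMatrix, dotProduct, Fin.sum_univ_succ]
    · linear_combination (t ^ 2 * (w 0 * x 0 + w 1 * x 1 + w 2 * x 2) * w 0 - x 0) * hw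
    · linear_combination (t ^ 2 * (w 0 * x 0 + w 1 * x 1 + w 2 * x 2) * w 1 - x 1) * hw
    · linear_combination (t ^ 2 * (w 0 * x 0 + w 1 * x 1 + w 2 * x 2) * w 2 - x 2) * hw
  have key : ∀ x, ((1 + t' ^ 2) * (z ⬝ᵥ (C *ᵥ x))) • z =
      ((1 + t ^ 2) * (w ⬝ᵥ x)) • (C *ᵥ w) := by
    intro x
    have h1 := hCB (C *ᵥ x)
    rw [hBC, hsq _ _ _ hw, hsq _ _ _ hz, mulVec_neg, mulVec_smul] at h1
    exact (neg_injective h1).symm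
  have ht : 1 + t ^ 2 ≠ 0 := by positivity
  have ht' : 1 + t' ^ 2 ≠ 0 := by positivity
  have hperp : ∀ x, w ⬝ᵥ x = 0 → C *ᵥ x = 0 := by
    intro x hx
    have hzu : z ⬝ᵥ (C *ᵥ x) = 0 := by
      have h := congrArg (z ⬝ᵥ ·) (key x)
      simpa [hx, hz, ht'] using h
    have h := hC x (axialMatrix t w *ᵥ x)
    have hAA : axialMatrix t w *ᵥ (axialMatrix t w *ᵥ x) = -x := by
      have := hsq t w x hw
      rw [hx] at this
      exact (neg_eq_of_add_eq_zero_right (by simpa using this)).symm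
    rw [hAA, cross_self, hCA, axialMatrix_mulVec t' z, hzu] at h
    generalize C *ᵥ x = u at h hzu ⊢
    simp only [map_neg, cross_self, mul_zero, zero_smul, zero_add, neg_zero, mulVec_zero] at h
    have hu : u ⬝ᵥ u = 0 := by
      have h2 := congrArg (z ⬝ᵥ ·) h
      simp [dotProduct, Fin.sum_univ_succ, cross_apply] at h2 hz hzu ⊢
      linear_combination -h2 - (u 0 * u 0 + u 1 * u 1 + u 2 * u 2) * hz
        + (z 0 * u 0 + z 1 * u 1 + z 2 * u 2) * hzu
    exact dotProduct_self_eq_zero.1 hu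
  refine ⟨(1 + t' ^ 2) * (z ⬝ᵥ (C *ᵥ w)) / (1 + t ^ 2), fun x => ?_⟩
  have hx : C *ᵥ x = (w ⬝ᵥ x) • (C *ᵥ w) := by
    have := hperp (x - (w ⬝ᵥ x) • w) (by simp [dotProduct_sub, hw])
    rwa [mulVec_sub, mulVec_smul, sub_eq_zero] at this
  have hk := key w
  rw [hw, mul_one] at hk
  have hCw : C *ᵥ w = ((1 + t' ^ 2) * (z ⬝ᵥ (C *ᵥ w)) / (1 + t ^ 2)) • z := by
    rw [div_eq_inv_mul, mul_smul, hk, smul_smul, inv_mul_cancel₀ ht, one_smul]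
  rw [hx, mul_comm, mul_smul, ← hCw]

/-- The vector of `ℝ⁶` with halves `x` and `y`. -/
def joinVec (x y : Fin 3 → ℝ) : Fin 6 → ℝ := Sum.elim x y ∘ (finSumFinEquiv (m := 3) (n := 3)).symm

/-- The 6×6 matrix with 3×3 blocks `A`, `B`, `C`, `D`. -/
def blockMatrix (A B C D : Matrix (Fin 3) (Fin 3) ℝ) : Matrix (Fin 6) (Fin 6) ℝ :=
  (fromBlocks A B C D).submatrix (finSumFinEquiv (m := 3) (n := 3)).symm
    (finSumFinEquiv (m := 3) (n := 3)).symm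

/-- The 3×3 blocks of a 6×6 matrix, assembled into a matrix indexed by `Fin 3 ⊕ Fin 3`. -/
def splitMatrix (J : Matrix (Fin 6) (Fin 6) ℝ) : Matrix (Fin 3 ⊕ Fin 3) (Fin 3 ⊕ Fin 3) ℝ :=
  J.submatrix (finSumFinEquiv (m := 3) (n := 3)) (finSumFinEquiv (m := 3) (n := 3))

lemma splitMatrix_blockMatrix (A B C D : Matrix (Fin 3) (Fin 3) ℝ) :
    splitMatrix (blockMatrix A B C D) = fromBlocks A B C D := by
  ext i j
  simp [splitMatrix, blockMatrix]

lemma blockMatrix_splitMatrix (J : Matrix (Fin 6) (Fin 6) ℝ) :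
    blockMatrix (splitMatrix J).toBlocks₁₁ (splitMatrix J).toBlocks₁₂ (splitMatrix J).toBlocks₂₁
      (splitMatrix J).toBlocks₂₂ = J := by
  rw [blockMatrix, fromBlocks_toBlocks]
  ext i j
  simp [splitMatrix]

lemma joinVec_inj {x y x' y' : Fin 3 → ℝ} :
    joinVec x y = joinVec x' y' ↔ x = x' ∧ y = y' := by
  unfold joinVec
  rw [(finSumFinEquiv (m := 3) (n := 3)).symm.surjective.injective_comp_right.eq_iff,
    Sum.elim_eq_iff]

lemma exists_eq_joinVec (X : Fin 6 → ℝ) : ∃ x y, X = joinVec x y :=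
  ⟨X ∘ finSumFinEquiv (m := 3) (n := 3) ∘ Sum.inl,
    X ∘ finSumFinEquiv (m := 3) (n := 3) ∘ Sum.inr, by
      ext i
      obtain ⟨j, rfl⟩ := (finSumFinEquiv (m := 3) (n := 3)).surjective i
      cases j <;> simp [joinVec]⟩

lemma joinVec_sub (x y x' y' : Fin 3 → ℝ) :
    joinVec x y - joinVec x' y' = joinVec (x - x') (y - y') := by
  ext i
  obtain ⟨j, rfl⟩ := (finSumFinEquiv (m := 3) (n := 3)).surjective i
  cases j <;> simp [joinVec]

lemma neg_joinVec (x y : Fin 3 → ℝ) : -joinVec x y = joinVec (-x) (-y) := by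
  ext i
  obtain ⟨j, rfl⟩ := (finSumFinEquiv (m := 3) (n := 3)).surjective i
  cases j <;> simp [joinVec]

lemma joinVec_zero : joinVec 0 0 = 0 := by
  ext i
  obtain ⟨j, rfl⟩ := (finSumFinEquiv (m := 3) (n := 3)).surjective i
  cases j <;> simp [joinVec]

lemma blockMatrix_mulVec_joinVec (A B C D : Matrix (Fin 3) (Fin 3) ℝ) (x y : Fin 3 → ℝ) :
    blockMatrix A B C D *ᵥ joinVec x y = joinVec (A *ᵥ x + B *ᵥ y) (C *ᵥ x + D *ᵥ y) := by
  rw [blockMatrix, submatrix_mulVec_equiv, fromBlocks_mulVec]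
  simp [joinVec, Function.comp_assoc]

lemma bra6_joinVec (x y x' y' : Fin 3 → ℝ) :
    bra6 (joinVec x y) (joinVec x' y') = joinVec (x ⨯₃ x') (y ⨯₃ y') := by
  rw [cross_apply, cross_apply]
  ext i
  fin_cases i <;> rfl

lemma isCx6_blockMatrix {A B C D : Matrix (Fin 3) (Fin 3) ℝ} :
    isCx6 (blockMatrix A B C D) ↔
      (∀ x y, A *ᵥ (A *ᵥ x + B *ᵥ y) + B *ᵥ (C *ᵥ x + D *ᵥ y) = -x ∧
        C *ᵥ (A *ᵥ x + B *ᵥ y) + D *ᵥ (C *ᵥ x + D *ᵥ y) = -y) ∧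
      ∀ x y x' y',
        (A *ᵥ x + B *ᵥ y) ⨯₃ (A *ᵥ x' + B *ᵥ y') - x ⨯₃ x'
          - (A *ᵥ ((A *ᵥ x + B *ᵥ y) ⨯₃ x') + B *ᵥ ((C *ᵥ x + D *ᵥ y) ⨯₃ y'))
          - (A *ᵥ (x ⨯₃ (A *ᵥ x' + B *ᵥ y')) + B *ᵥ (y ⨯₃ (C *ᵥ x' + D *ᵥ y'))) = 0 ∧
        (C *ᵥ x + D *ᵥ y) ⨯₃ (C *ᵥ x' + D *ᵥ y') - y ⨯₃ y'
          - (C *ᵥ ((A *ᵥ x + B *ᵥ y) ⨯₃ x') + D *ᵥ ((C *ᵥ x + D *ᵥ y) ⨯₃ y'))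
          - (C *ᵥ (x ⨯₃ (A *ᵥ x' + B *ᵥ y')) + D *ᵥ (y ⨯₃ (C *ᵥ x' + D *ᵥ y'))) = 0 := by
  have hforall : ∀ P : (Fin 6 → ℝ) → Prop, (∀ X, P X) ↔ ∀ x y, P (joinVec x y) := fun P =>
    ⟨fun h _ _ => h _, fun h X => by obtain ⟨x, y, rfl⟩ := exists_eq_joinVec X; exact h x y⟩
  refine and_congr ?_ ?_
  · rw [← mulVec_injective.eq_iff, funext_iff, hforall]
    simp only [← mulVec_mulVec, neg_mulVec, one_mulVec, blockMatrix_mulVec_joinVec, neg_joinVec,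
      joinVec_inj]
  · unfold torsion6
    simp only [hforall, blockMatrix_mulVec_joinVec, bra6_joinVec, joinVec_sub, ← joinVec_zero,
      joinVec_inj]

lemma isCx6_blockMatrix_swap {A B C D : Matrix (Fin 3) (Fin 3) ℝ}
    (h : isCx6 (blockMatrix A B C D)) : isCx6 (blockMatrix D C B A) := by
  rw [isCx6_blockMatrix] at h ⊢
  refine ⟨fun x y => ?_, fun x y x' y' => ?_⟩
  · have := h.1 y x
    simpa only [add_comm] using this.symm
  · have := h.2 y x y' x'
    simpa only [add_comm] using this.symm

/-- The complex structure with invariants `t`, `c` and axes `w`, `z`. -/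
noncomputable def cxOf (t c : ℝ) (w z : Fin 3 → ℝ) : Matrix (Fin 6) (Fin 6) ℝ :=
  blockMatrix (axialMatrix t w) (c • vecMulVec w z) ((-(1 + t ^ 2) / c) • vecMulVec z w)
    (axialMatrix (-t) z)

lemma smul_vecMulVec_mulVec (c : ℝ) (w z x : Fin 3 → ℝ) :
    (c • vecMulVec w z) *ᵥ x = (c * (z ⬝ᵥ x)) • w := by
  rw [smul_mulVec, vecMulVec_mulVec, op_smul_eq_smul, smul_smul]

lemma dotProduct_self_eq (w : Fin 3 → ℝ) : w ⬝ᵥ w = w 0 ^ 2 + w 1 ^ 2 + w 2 ^ 2 := by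
  simp only [dotProduct, Fin.sum_univ_three]
  ring

lemma cross_cross_self {w : Fin 3 → ℝ} (hw : w ⬝ᵥ w = 1) (x : Fin 3 → ℝ) :
    w ⨯₃ (w ⨯₃ x) = (w ⬝ᵥ x) • w - x := by
  rw [dotProduct_self_eq] at hw
  ext i
  fin_cases i <;> simp [cross_apply, dotProduct, Fin.sum_univ_three]
  · linear_combination -x 0 * hw
  · linear_combination -x 1 * hw
  · linear_combination -x 2 * hw

lemma dotProduct_axial_bracket {w : Fin 3 → ℝ} (a a' : ℝ) (x x' : Fin 3 → ℝ) :
    w ⬝ᵥ ((a • w + w ⨯₃ x) ⨯₃ x') + w ⬝ᵥ (x ⨯₃ (a' • w + w ⨯₃ x')) = 0 := by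
  simp [vecHead, vecTail, cross_apply, dotProduct, Fin.sum_univ_three]
  ring

lemma axial_cross_axial {w : Fin 3 → ℝ} (hw : w ⬝ᵥ w = 1) (a a' : ℝ) (x x' : Fin 3 → ℝ) :
    (a • w + w ⨯₃ x) ⨯₃ (a' • w + w ⨯₃ x') - x ⨯₃ x' =
      w ⨯₃ ((a • w + w ⨯₃ x) ⨯₃ x') + w ⨯₃ (x ⨯₃ (a' • w + w ⨯₃ x')) := by
  rw [dotProduct_self_eq] at hw
  ext i
  fin_cases i <;> simp [vecHead, vecTail, cross_apply]
  · linear_combination (x 1 * x' 2 - x 2 * x' 1) * hw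
  · linear_combination (x 2 * x' 0 - x 0 * x' 2) * hw
  · linear_combination (x 0 * x' 1 - x 1 * x' 0) * hw

lemma isCx6_cxOf (t : ℝ) {c : ℝ} (hc : c ≠ 0) {w z : Fin 3 → ℝ} (hw : w ⬝ᵥ w = 1)
    (hz : z ⬝ᵥ z = 1) : isCx6 (cxOf t c w z) := by
  obtain ⟨d, hd⟩ : ∃ d, d = -(1 + t ^ 2) / c := ⟨_, rfl⟩
  have hcd : c * d = -(1 + t ^ 2) := by rw [hd]; field_simp
  have h1 : ∀ x y, axialMatrix t w *ᵥ x + (c • vecMulVec w z) *ᵥ y =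
      (t * (w ⬝ᵥ x) + c * (z ⬝ᵥ y)) • w + w ⨯₃ x := fun x y => by
    rw [axialMatrix_mulVec, smul_vecMulVec_mulVec]; module
  have h2 : ∀ x y, (d • vecMulVec z w) *ᵥ x + axialMatrix (-t) z *ᵥ y =
      (d * (w ⬝ᵥ x) - t * (z ⬝ᵥ y)) • z + z ⨯₃ y := fun x y => by
    rw [axialMatrix_mulVec, smul_vecMulVec_mulVec]; module
  rw [cxOf, ← hd, isCx6_blockMatrix]
  simp only [h1, h2]
  refine ⟨fun x y => ⟨?_, ?_⟩, fun x y x' y' => ⟨?_, ?_⟩⟩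
  · simp only [dotProduct_add, dotProduct_smul, dot_self_cross, map_add, map_smul, cross_self,
      cross_cross_self hw, hw, hz, smul_eq_mul, mul_one, add_zero, smul_zero, zero_add]
    linear_combination (norm := module) (w ⬝ᵥ x) • congrArg (· • w) hcd
  · simp only [dotProduct_add, dotProduct_smul, dot_self_cross, map_add, map_smul, cross_self,
      cross_cross_self hz, hw, hz, smul_eq_mul, mul_one, add_zero, smul_zero, zero_add]
    linear_combination (norm := module) (z ⬝ᵥ y) • congrArg (· • z) hcd
  · have hx := dotProduct_axial_bracket (w := w) (t * (w ⬝ᵥ x) + c * (z ⬝ᵥ y))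
      (t * (w ⬝ᵥ x') + c * (z ⬝ᵥ y')) x x'
    have hy := dotProduct_axial_bracket (w := z) (d * (w ⬝ᵥ x) - t * (z ⬝ᵥ y))
      (d * (w ⬝ᵥ x') - t * (z ⬝ᵥ y')) y y'
    rw [axial_cross_axial hw]
    linear_combination (norm := module) (-t) • congrArg (· • w) hx - c • congrArg (· • w) hy
  · have hx := dotProduct_axial_bracket (w := w) (t * (w ⬝ᵥ x) + c * (z ⬝ᵥ y))
      (t * (w ⬝ᵥ x') + c * (z ⬝ᵥ y')) x x'
    have hy := dotProduct_axial_bracket (w := z) (d * (w ⬝ᵥ x) - t * (z ⬝ᵥ y))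
      (d * (w ⬝ᵥ x') - t * (z ⬝ᵥ y')) y y'
    rw [axial_cross_axial hz]
    linear_combination (norm := module) (-d) • congrArg (· • z) hx + t • congrArg (· • z) hy

/-- The upper left block of a complex structure is axial. -/
lemma exists_eq_axialMatrix_of_isCx6 {A B C D : Matrix (Fin 3) (Fin 3) ℝ}
    (h : isCx6 (blockMatrix A B C D)) :
    ∃ (t : ℝ) (w : Fin 3 → ℝ), w ⬝ᵥ w = 1 ∧ A = axialMatrix t w := by
  simp only [dotProduct_self_eq]
  refine exists_eq_axialMatrix A fun x y => ?_
  simpa using ((isCx6_blockMatrix.1 h).2 x 0 y 0).1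

/-- The lower left block of a complex structure with axial diagonal blocks has rank one. -/
lemma exists_eq_smul_vecMulVec_of_isCx6 {t t' : ℝ} {w z : Fin 3 → ℝ} 
    {B C : Matrix (Fin 3) (Fin 3) ℝ}
    (hw : w ⬝ᵥ w = 1) (hz : z ⬝ᵥ z = 1)
    (h : isCx6 (blockMatrix (axialMatrix t w) B C (axialMatrix t' z))) :
    ∃ d : ℝ, C = d • vecMulVec z w := by
  rw [isCx6_blockMatrix] at h
  obtain ⟨d, hd⟩ := mulVec_eq_of_axialMatrix (B := B) (C := C) (t := t) (t' := t') hw hz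
    (fun x y => by
      have := (h.2 x 0 y 0).2
      simp only [mulVec_zero, add_zero, map_zero, LinearMap.zero_apply, sub_zero] at this
      rw [mulVec_add]
      linear_combination this)
    (fun x => by
      have := (h.1 x 0).1
      simp only [mulVec_zero, add_zero] at this
      linear_combination this)
    (fun x => by
      have := (h.1 0 x).2
      simp only [mulVec_zero, zero_add] at this
      linear_combination this)
    (fun x => by
      have := (h.1 x 0).2
      simp only [mulVec_zero, add_zero] at this
      linear_combination this)
  refine ⟨d, mulVec_injective (funext fun x => ?_)⟩
  rw [hd, smul_vecMulVec_mulVec]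

lemma exists_eq_cxOf {J : Matrix (Fin 6) (Fin 6) ℝ} (h : isCx6 J) :
    ∃ (t c : ℝ) (w z : Fin 3 → ℝ), c ≠ 0 ∧ w ⬝ᵥ w = 1 ∧ z ⬝ᵥ z = 1 ∧ J = cxOf t c w z := by
  rw [← blockMatrix_splitMatrix J] at h ⊢
  generalize (splitMatrix J).toBlocks₁₁ = A at *
  generalize (splitMatrix J).toBlocks₁₂ = B at *
  generalize (splitMatrix J).toBlocks₂₁ = C at *
  generalize (splitMatrix J).toBlocks₂₂ = D at *
  obtain ⟨t, w, hw, rfl⟩ := exists_eq_axialMatrix_of_isCx6 h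
  obtain ⟨t', z, hz, rfl⟩ := exists_eq_axialMatrix_of_isCx6 (isCx6_blockMatrix_swap h)
  obtain ⟨d, rfl⟩ := exists_eq_smul_vecMulVec_of_isCx6 hw hz h
  obtain ⟨c, rfl⟩ := exists_eq_smul_vecMulVec_of_isCx6 hz hw (isCx6_blockMatrix_swap h)
  rw [isCx6_blockMatrix] at h
  have h1 := congrArg (w ⬝ᵥ ·) (h.1 w 0).1
  have h2 := congrArg (w ⬝ᵥ ·) (h.1 0 z).1
  simp only [mulVec_zero, add_zero, zero_add, axialMatrix_mulVec, smul_vecMulVec_mulVec, cross_self,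
    dotProduct_add, dotProduct_smul, dot_self_cross, hw, hz, smul_eq_mul, mul_one, dotProduct_neg,
    neg_zero, dotProduct_zero] at h1 h2
  have hc : c ≠ 0 := by
    rintro rfl
    nlinarith [sq_nonneg t]
  have ht : t' = -t := by
    have : c * (t + t') = 0 := by linear_combination h2
    have := (mul_eq_zero.1 this).resolve_left hc
    linarith
  have hd : d = -(1 + t ^ 2) / c := by
    rw [eq_div_iff hc]
    linear_combination h1
  exact ⟨t, c, w, z, hc, hw, hz, by rw [cxOf, ht, hd]⟩

/-- The vector representing the antisymmetric part of a 3×3 matrix. -/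
noncomputable def axis (A : Matrix (Fin 3) (Fin 3) ℝ) : Fin 3 → ℝ :=
  ![(A 2 1 - A 1 2) / 2, (A 0 2 - A 2 0) / 2, (A 1 0 - A 0 1) / 2]

lemma axis_axialMatrix (t : ℝ) (w : Fin 3 → ℝ) : axis (axialMatrix t w) = w := by
  ext i
  fin_cases i <;> simp [axis, axialMatrix] <;> ring

lemma trace_axialMatrix (t : ℝ) {w : Fin 3 → ℝ} (hw : w ⬝ᵥ w = 1) :
    (axialMatrix t w).trace = t := by
  rw [dotProduct_self_eq] at hw
  simp [axialMatrix, trace, Fin.sum_univ_three]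
  linear_combination t * hw

lemma continuous_axis : Continuous axis := by
  refine continuous_pi fun i => ?_
  fin_cases i <;> simp [axis] <;> fun_prop

lemma continuous_axialMatrix : Continuous fun p : ℝ × (Fin 3 → ℝ) => axialMatrix p.1 p.2 := by
  refine continuous_matrix fun i j => ?_
  fin_cases i <;> fin_cases j <;> simp [axialMatrix] <;> fun_prop

lemma continuous_splitMatrix : Continuous splitMatrix :=
  continuous_id.matrix_submatrix _ _

lemma isOpen_U6 : IsOpen U6 := by
  refine IsOpen.inter ?_ (IsOpen.inter ?_ ?_) <;>
    exact isOpen_ne_fun (by fun_prop) continuous_const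

lemma X6_subset_U6 : X6 ⊆ U6 := by
  intro J hJ
  obtain ⟨t, c, w, z, hc, hw, hz, rfl⟩ := exists_eq_cxOf hJ
  rw [dotProduct_self_eq] at hw hz
  refine ⟨?_, ?_, ?_⟩
  · change (c * (w 0 * z 0)) ^ 2 + (c * (w 0 * z 1)) ^ 2 + (c * (w 0 * z 2)) ^ 2
      + (c * (w 1 * z 0)) ^ 2 + (c * (w 1 * z 1)) ^ 2 + (c * (w 1 * z 2)) ^ 2
      + (c * (w 2 * z 0)) ^ 2 + (c * (w 2 * z 1)) ^ 2 + (c * (w 2 * z 2)) ^ 2 ≠ 0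
    have : c ^ 2 * (w 0 ^ 2 + w 1 ^ 2 + w 2 ^ 2) * (z 0 ^ 2 + z 1 ^ 2 + z 2 ^ 2) ≠ 0 := by
      rw [hw, hz]; simpa using hc
    convert this using 1
    ring
  · change (t * w 1 * w 2 - w 0 - (t * w 2 * w 1 + w 0),
      t * w 0 * w 2 + w 1 - (t * w 2 * w 0 - w 1),
      t * w 0 * w 1 - w 2 - (t * w 1 * w 0 + w 2)) ≠ ((0, 0, 0) : ℝ × ℝ × ℝ)
    intro h
    simp only [Prod.mk.injEq] at h
    have h0 : w 0 = 0 := by linarith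
    have h1 : w 1 = 0 := by linarith
    have h2 : w 2 = 0 := by linarith
    simp [h0, h1, h2] at hw
  · change (-t * z 1 * z 2 - z 0 - (-t * z 2 * z 1 + z 0),
      -t * z 0 * z 2 + z 1 - (-t * z 2 * z 0 - z 1),
      -t * z 0 * z 1 - z 2 - (-t * z 1 * z 0 + z 2)) ≠ ((0, 0, 0) : ℝ × ℝ × ℝ)
    intro h
    simp only [Prod.mk.injEq] at h
    have h0 : z 0 = 0 := by linarith
    have h1 : z 1 = 0 := by linarith
    have h2 : z 2 = 0 := by linarith
    simp [h0, h1, h2] at hz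

lemma continuous_bra6 : Continuous fun p : (Fin 6 → ℝ) × (Fin 6 → ℝ) => bra6 p.1 p.2 := by
  refine continuous_pi fun i => ?_
  fin_cases i <;> simp [bra6] <;> fun_prop

lemma isClosed_X6 : IsClosed X6 := by
  have hX6 : X6 = {J | J * J = -1} ∩ ⋂ X, ⋂ Y, {J | bra6 (J *ᵥ X) (J *ᵥ Y) - bra6 X Y
      - J *ᵥ bra6 (J *ᵥ X) Y - J *ᵥ bra6 X (J *ᵥ Y) = 0} := by
    ext J
    simp [X6, isCx6, torsion6]
  rw [hX6]
  refine IsClosed.inter (isClosed_eq (by fun_prop) continuous_const) ?_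
  refine isClosed_iInter fun X => isClosed_iInter fun Y => isClosed_eq ?_ continuous_const
  have hJ : ∀ {f : Matrix (Fin 6) (Fin 6) ℝ → Fin 6 → ℝ}, Continuous f →
      Continuous fun J : Matrix (Fin 6) (Fin 6) ℝ => J *ᵥ f J :=
    fun hf => continuous_id.matrix_mulVec hf
  have hb : ∀ {f g : Matrix (Fin 6) (Fin 6) ℝ → Fin 6 → ℝ}, Continuous f → Continuous g →
      Continuous fun J => bra6 (f J) (g J) :=
    fun hf hg => continuous_bra6.comp (hf.prodMk hg)
  have hX := hJ (continuous_const (y := X))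
  have hY := hJ (continuous_const (y := Y))
  exact (((hb hX hY).sub continuous_const).sub (hJ (hb hX continuous_const))).sub
    (hJ (hb continuous_const hY))

/-- The invariants `t`, `c`, `w`, `z` of a complex structure `cxOf t c w z`. -/
noncomputable def cxInvariants (J : Matrix (Fin 6) (Fin 6) ℝ) :
    ℝ × ℝ × (Fin 3 → ℝ) × (Fin 3 → ℝ) :=
  ((splitMatrix J).toBlocks₁₁.trace,
    axis (splitMatrix J).toBlocks₁₁ ⬝ᵥ
      ((splitMatrix J).toBlocks₁₂ *ᵥ axis (splitMatrix J).toBlocks₂₂),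
    axis (splitMatrix J).toBlocks₁₁, axis (splitMatrix J).toBlocks₂₂)

lemma cxInvariants_cxOf (t c : ℝ) {w z : Fin 3 → ℝ} (hw : w ⬝ᵥ w = 1) (hz : z ⬝ᵥ z = 1) :
    cxInvariants (cxOf t c w z) = (t, c, w, z) := by
  simp only [cxInvariants, cxOf, splitMatrix_blockMatrix, toBlocks_fromBlocks₁₁,
    toBlocks_fromBlocks₁₂, toBlocks_fromBlocks₂₂, axis_axialMatrix, trace_axialMatrix t hw,
    smul_vecMulVec_mulVec, dotProduct_smul, hw, hz, smul_eq_mul, mul_one]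

lemma continuous_cxInvariants : Continuous cxInvariants := by
  have h11 : Continuous fun J => (splitMatrix J).toBlocks₁₁ :=
    continuous_splitMatrix.matrix_submatrix _ _
  have h12 : Continuous fun J => (splitMatrix J).toBlocks₁₂ :=
    continuous_splitMatrix.matrix_submatrix _ _
  have h22 : Continuous fun J => (splitMatrix J).toBlocks₂₂ :=
    continuous_splitMatrix.matrix_submatrix _ _
  have hw := continuous_axis.comp h11
  have hz := continuous_axis.comp h22
  exact h11.matrix_trace.prodMk
    ((hw.dotProduct (h12.matrix_mulVec hz)).prodMk (hw.prodMk hz))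

lemma continuous_cxOf :
    Continuous fun p : ℝ × {c : ℝ // c ≠ 0} × (Fin 3 → ℝ) × (Fin 3 → ℝ) =>
      cxOf p.1 p.2.1 p.2.2.1 p.2.2.2 := by
  have hw : Continuous fun p : ℝ × {c : ℝ // c ≠ 0} × (Fin 3 → ℝ) × (Fin 3 → ℝ) => p.2.2.1 := by
    fun_prop
  have hz : Continuous fun p : ℝ × {c : ℝ // c ≠ 0} × (Fin 3 → ℝ) × (Fin 3 → ℝ) => p.2.2.2 := by
    fun_prop
  have hc : Continuous fun p : ℝ × {c : ℝ // c ≠ 0} × (Fin 3 → ℝ) × (Fin 3 → ℝ) =>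
      (p.2.1 : ℝ) := by
    fun_prop
  have ht : Continuous fun p : ℝ × {c : ℝ // c ≠ 0} × (Fin 3 → ℝ) × (Fin 3 → ℝ) => p.1 := by
    fun_prop
  refine Continuous.matrix_submatrix (Continuous.matrix_fromBlocks ?_ ?_ ?_ ?_) _ _
  · exact continuous_axialMatrix.comp (ht.prodMk hw)
  · exact hc.smul (hw.matrix_vecMulVec hz)
  · exact ((continuous_const.add (ht.pow 2)).neg.div hc fun p => p.2.1.2).smul
      (hz.matrix_vecMulVec hw)
  · exact continuous_axialMatrix.comp (ht.neg.prodMk hz)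

/-- The parametrisation of the complex structures by their invariants. -/
noncomputable def homeomorphX6 : ↥X6 ≃ₜ
    ℝ × {η : ℝ // η ≠ 0} × {v : Fin 3 → ℝ // (v 0) ^ 2 + (v 1) ^ 2 + (v 2) ^ 2 = 1}
      × {v : Fin 3 → ℝ // (v 0) ^ 2 + (v 1) ^ 2 + (v 2) ^ 2 = 1} where
  toFun J :=
    have hJ : (cxInvariants J).2.1 ≠ 0 ∧
        (cxInvariants J).2.2.1 ⬝ᵥ (cxInvariants J).2.2.1 = 1 ∧
        (cxInvariants J).2.2.2 ⬝ᵥ (cxInvariants J).2.2.2 = 1 := by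
      obtain ⟨t, c, w, z, hc, hw, hz, h⟩ := exists_eq_cxOf J.2
      rw [h, cxInvariants_cxOf t c hw hz]
      exact ⟨hc, hw, hz⟩
    ((cxInvariants J).1, ⟨(cxInvariants J).2.1, hJ.1⟩,
      ⟨(cxInvariants J).2.2.1, (dotProduct_self_eq _).symm.trans hJ.2.1⟩,
      ⟨(cxInvariants J).2.2.2, (dotProduct_self_eq _).symm.trans hJ.2.2⟩)
  invFun p := ⟨cxOf p.1 p.2.1 p.2.2.1 p.2.2.2,
    isCx6_cxOf p.1 p.2.1.2 ((dotProduct_self_eq _).trans p.2.2.1.2)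
      ((dotProduct_self_eq _).trans p.2.2.2.2)⟩
  left_inv J := by
    obtain ⟨J, hJ⟩ := J
    obtain ⟨t, c, w, z, hc, hw, hz, rfl⟩ := exists_eq_cxOf hJ
    ext1
    simp only [cxInvariants_cxOf t c hw hz]
  right_inv p := by
    obtain ⟨t, ⟨c, hc⟩, ⟨w, hw⟩, ⟨z, hz⟩⟩ := p
    rw [← dotProduct_self_eq] at hw hz
    simp only [cxInvariants_cxOf t c hw hz]
  continuous_toFun := by
    have h : Continuous fun J : ↥X6 => cxInvariants J :=
      continuous_cxInvariants.comp continuous_subtype_val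
    exact h.fst.prodMk ((h.snd.fst.subtype_mk _).prodMk
      ((h.snd.snd.fst.subtype_mk _).prodMk (h.snd.snd.snd.subtype_mk _)))
  continuous_invFun := by
    have h : Continuous fun p : ℝ × {η : ℝ // η ≠ 0}
        × {v : Fin 3 → ℝ // (v 0) ^ 2 + (v 1) ^ 2 + (v 2) ^ 2 = 1}
        × {v : Fin 3 → ℝ // (v 0) ^ 2 + (v 1) ^ 2 + (v 2) ^ 2 = 1} =>
        (p.1, p.2.1, p.2.2.1.1, p.2.2.2.1) := by fun_prop
    exact (continuous_cxOf.comp h).subtype_mk _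

/-- The set of complex structures on su(2) ⊕ su(2) is contained in the open set `U6`,
is closed in `U6`, and is homeomorphic to ℝ × (ℝ ∖ {0}) × S² × S². -/
theorem stmt13 :
    IsOpen U6 ∧ X6 ⊆ U6 ∧
    (∃ C : Set (Matrix (Fin 6) (Fin 6) ℝ), IsClosed C ∧ X6 = C ∩ U6) ∧
    Nonempty (↥X6 ≃ₜ
      ℝ × {η : ℝ // η ≠ 0} × {v : Fin 3 → ℝ // (v 0) ^ 2 + (v 1) ^ 2 + (v 2) ^ 2 = 1}
        × {v : Fin 3 → ℝ // (v 0) ^ 2 + (v 1) ^ 2 + (v 2) ^ 2 = 1}) := by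
  exact ⟨isOpen_U6, X6_subset_U6,
    ⟨X6, isClosed_X6, (Set.inter_eq_left.2 X6_subset_U6).symm⟩, ⟨homeomorphX6⟩⟩
end

section
/- Let N ≥ 1 and let J : su(2)^N → su(2)^N be a linear map. J has zero torsion if and only if there exist Φ ∈ SO(3)^N (acting block-diagonally on (ℝ³)^N) and a real N×N matrix M = (m_{ij}) such that Φ⁻¹ J Φ = J(M), where J(M) is the block matrix whose i-th diagonal 3×3 block has rows (0,1,0), (−1,0,0), (0,0,m_{ii}), and whose (i,j) off-diagonal 3×3 block (i ≠ j) is the diagonal matrix diag(0,0,m_{ij}). -/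
/-- The cross product on ℝ³ (the Lie bracket of su(2)). -/
def cross (x y : Fin 3 → ℝ) : Fin 3 → ℝ :=
  ![x 1 * y 2 - x 2 * y 1, x 2 * y 0 - x 0 * y 2, x 0 * y 1 - x 1 * y 0]

/-- The componentwise cross-product Lie bracket of su(2)^N ≅ (ℝ³)^N. -/
def braN {N : ℕ} (x y : Fin N → Fin 3 → ℝ) : Fin N → Fin 3 → ℝ :=
  fun i => cross (x i) (y i)

/-- The normal form J(M): the i-th diagonal 3×3 block has rows (0,1,0), (−1,0,0),
(0,0,m_ii), and the (i,j) off-diagonal block (i ≠ j) is diag(0,0,m_ij); applied to a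
vector x ∈ (ℝ³)^N. -/
def JMapp {N : ℕ} (M : Matrix (Fin N) (Fin N) ℝ) (x : Fin N → Fin 3 → ℝ) :
    Fin N → Fin 3 → ℝ :=
  fun i => ![x i 1, -(x i 0), ∑ j, M i j * x j 2]

open Matrix

/-- The torsion of `J` with respect to a bracket `b`. -/
def torsion {V : Type*} [AddCommGroup V] (b : V → V → V) (J : V → V) (X Y : V) : V :=
  b (J X) (J Y) - b X Y - J (b (J X) Y) - J (b X (J Y))

/-- Torsion is natural under maps that preserve the bracket and intertwine `J'` with `J`. -/
theorem torsion_map {V : Type*} [AddCommGroup V] (b : V → V → V) (ρ : V →+ V)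
    (hρ : ∀ x y, b (ρ x) (ρ y) = ρ (b x y)) (J J' : V → V)
    (h : ∀ x, J (ρ x) = ρ (J' x)) (X Y : V) :
    torsion b J (ρ X) (ρ Y) = ρ (torsion b J' X Y) := by
  simp only [torsion, h, hρ, map_sub]

theorem so3.transpose_mul {R : Matrix (Fin 3) (Fin 3) ℝ} (hR : so3 R) : Rᵀ * R = 1 :=
  mul_eq_one_comm.mp hR.1

theorem so3.mul {R S : Matrix (Fin 3) (Fin 3) ℝ} (hR : so3 R) (hS : so3 S) : so3 (R * S) := by
  refine ⟨?_, by rw [det_mul, hR.2, hS.2, one_mul]⟩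
  rw [Matrix.transpose_mul, Matrix.mul_assoc, ← Matrix.mul_assoc S, hS.1, Matrix.one_mul, hR.1]

theorem so3.mulVec_transpose_mulVec {R : Matrix (Fin 3) (Fin 3) ℝ} (hR : so3 R)
    (x : Fin 3 → ℝ) : R *ᵥ (Rᵀ *ᵥ x) = x := by
  rw [mulVec_mulVec, hR.1, one_mulVec]

theorem so3.transpose_mulVec_mulVec {R : Matrix (Fin 3) (Fin 3) ℝ} (hR : so3 R)
    (x : Fin 3 → ℝ) : Rᵀ *ᵥ (R *ᵥ x) = x := by
  rw [mulVec_mulVec, hR.transpose_mul, one_mulVec]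

/-- The cofactor identity `Rᵀ (R x × R y) = det R • (x × y)`. -/
theorem transpose_mulVec_cross_mulVec (R : Matrix (Fin 3) (Fin 3) ℝ) (x y : Fin 3 → ℝ) :
    Rᵀ *ᵥ cross (R *ᵥ x) (R *ᵥ y) = R.det • cross x y := by
  ext i
  fin_cases i <;>
    simp [cross, mulVec, dotProduct, Fin.sum_univ_three, det_fin_three] <;> ring

theorem so3.cross_mulVec {R : Matrix (Fin 3) (Fin 3) ℝ} (hR : so3 R) (x y : Fin 3 → ℝ) :
    cross (R *ᵥ x) (R *ᵥ y) = R *ᵥ cross x y := by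
  have h := transpose_mulVec_cross_mulVec R x y
  rw [hR.2, one_smul] at h
  rw [← h, hR.mulVec_transpose_mulVec]

/-- Every unit vector is the third column of a rotation. -/
theorem exists_so3_col_two (v : Fin 3 → ℝ) (hv : v 0 ^ 2 + v 1 ^ 2 + v 2 ^ 2 = 1) :
    ∃ R, so3 R ∧ R *ᵥ ![0, 0, 1] = v := by
  obtain ⟨u, hu, huv⟩ : ∃ u : Fin 3 → ℝ, u 0 ^ 2 + u 1 ^ 2 + u 2 ^ 2 = 1 ∧
      u 0 * v 0 + u 1 * v 1 + u 2 * v 2 = 0 := by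
    by_cases h : v 0 ^ 2 + v 1 ^ 2 = 0
    · refine ⟨![1, 0, 0], by simp, ?_⟩
      have : v 0 = 0 := by nlinarith [sq_nonneg (v 0), sq_nonneg (v 1)]
      simp [this]
    · have hpos : 0 < v 0 ^ 2 + v 1 ^ 2 := lt_of_le_of_ne (by positivity) (Ne.symm h)
      have hs := Real.sq_sqrt hpos.le
      have hs0 : √(v 0 ^ 2 + v 1 ^ 2) ≠ 0 := (Real.sqrt_pos.mpr hpos).ne'
      refine ⟨![-v 1 / √(v 0 ^ 2 + v 1 ^ 2), v 0 / √(v 0 ^ 2 + v 1 ^ 2), 0], ?_, ?_⟩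
      · simp [div_pow, hs]
        field_simp
        ring
      · simp
        ring
  have horth : (!![u 0, v 1 * u 2 - v 2 * u 1, v 0; u 1, v 2 * u 0 - v 0 * u 2, v 1;
      u 2, v 0 * u 1 - v 1 * u 0, v 2])ᵀ * !![u 0, v 1 * u 2 - v 2 * u 1, v 0;
      u 1, v 2 * u 0 - v 0 * u 2, v 1; u 2, v 0 * u 1 - v 1 * u 0, v 2] = 1 := by
    ext i j
    fin_cases i <;> fin_cases j <;>
      simp [Matrix.mul_apply, Fin.sum_univ_three] <;> grind
  refine ⟨_, ⟨mul_eq_one_comm.mp horth, ?_⟩, ?_⟩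
  · simp [det_fin_three]
    grind
  · ext i
    fin_cases i <;> simp [mulVec, dotProduct, Fin.sum_univ_three]

theorem exists_root_cubic (p q r : ℝ) : ∃ t : ℝ, t ^ 3 + p * t ^ 2 + q * t + r = 0 := by
  set B := 1 + |p| + |q| + |r| with hB
  have hp := abs_nonneg p
  have hq := abs_nonneg q
  have hr := abs_nonneg r
  have hB1 : 1 ≤ B := by linarith
  have hqB : |q| * B ≤ |q| * B ^ 2 := by nlinarith [mul_nonneg hq (by linarith : 0 ≤ B)]
  have hrB : |r| ≤ |r| * B ^ 2 := le_mul_of_one_le_right hr (one_le_pow₀ hB1)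
  have hsum : |p| * B ^ 2 + |q| * B + |r| ≤ B ^ 3 := by
    have : B ^ 3 = (1 + |p| + |q| + |r|) * B ^ 2 := by rw [← hB]; ring
    nlinarith [sq_nonneg B]
  have hp1 : |p * B ^ 2| = |p| * B ^ 2 := by rw [abs_mul, abs_of_nonneg (sq_nonneg B)]
  have hq1 : |q * B| = |q| * B := by rw [abs_mul, abs_of_nonneg (by linarith : 0 ≤ B)]
  have hp2 := abs_le.mp hp1.le
  have hq2 := abs_le.mp hq1.le
  have hr2 := abs_le.mp (le_refl |r|)
  have hc : Continuous fun t : ℝ => t ^ 3 + p * t ^ 2 + q * t + r := by fun_prop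
  obtain ⟨t, -, ht⟩ := intermediate_value_Icc (by linarith : -B ≤ B) hc.continuousOn
    (show (0 : ℝ) ∈ _ from ⟨by nlinarith, by nlinarith⟩)
  exact ⟨t, ht⟩

/-- A real 3×3 matrix has a unit eigenvector. -/
theorem exists_unit_eigenvector (A : Matrix (Fin 3) (Fin 3) ℝ) :
    ∃ (m : ℝ) (v : Fin 3 → ℝ), v 0 ^ 2 + v 1 ^ 2 + v 2 ^ 2 = 1 ∧ A *ᵥ v = m • v := by
  obtain ⟨m, hm⟩ := exists_root_cubic (-(A 0 0 + A 1 1 + A 2 2))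
    (A 0 0 * A 1 1 - A 0 1 * A 1 0 + (A 0 0 * A 2 2 - A 0 2 * A 2 0) +
      (A 1 1 * A 2 2 - A 1 2 * A 2 1)) (-A.det)
  have hdet : (A - m • 1).det = 0 := by
    rw [det_fin_three] at hm ⊢
    simp
    linarith
  obtain ⟨w, hw0, hw⟩ := exists_mulVec_eq_zero_iff.mpr hdet
  rw [sub_mulVec, smul_mulVec, one_mulVec, sub_eq_zero] at hw
  have hpos : 0 < w 0 ^ 2 + w 1 ^ 2 + w 2 ^ 2 := by
    refine lt_of_le_of_ne (by positivity) fun h => hw0 ?_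
    ext i
    fin_cases i <;> simp <;> nlinarith [sq_nonneg (w 0), sq_nonneg (w 1), sq_nonneg (w 2)]
  have hs := Real.sq_sqrt hpos.le
  have hs0 := (Real.sqrt_pos.mpr hpos).ne'
  refine ⟨m, (√(w 0 ^ 2 + w 1 ^ 2 + w 2 ^ 2))⁻¹ • w, ?_, ?_⟩
  · simp only [Pi.smul_apply, smul_eq_mul, mul_pow, inv_pow, hs]
    field_simp
  · rw [mulVec_smul, hw, smul_comm]

/-- The entries of a torsion-free matrix on ℝ³ whose third column is `(0, 0, m)`. -/
theorem entries_of_torsion_eq_zero {A : Matrix (Fin 3) (Fin 3) ℝ} {m : ℝ}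
    (h02 : A 0 2 = 0) (h12 : A 1 2 = 0) (h22 : A 2 2 = m)
    (hA : ∀ x y, torsion cross (A *ᵥ ·) x y = 0) :
    A 0 0 = 0 ∧ A 1 1 = 0 ∧ A 2 0 = 0 ∧ A 2 1 = 0 ∧ A 1 0 = -A 0 1 ∧ A 0 1 ^ 2 = 1 := by
  have hmul : ∀ x, A *ᵥ x = ![A 0 0 * x 0 + A 0 1 * x 1, A 1 0 * x 0 + A 1 1 * x 1,
      A 2 0 * x 0 + A 2 1 * x 1 + m * x 2] := fun x => by
    ext i
    fin_cases i <;> simp [mulVec, dotProduct, Fin.sum_univ_three, h02, h12, h22]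
  have E := fun x y i => congrFun (hA x y) i
  have e1 := E ![1, 0, 0] ![0, 0, 1] 0
  have e2 := E ![1, 0, 0] ![0, 0, 1] 1
  have e3 := E ![1, 0, 0] ![0, 0, 1] 2
  have e4 := E ![0, 1, 0] ![0, 0, 1] 0
  have e5 := E ![0, 1, 0] ![0, 0, 1] 1
  have e6 := E ![0, 1, 0] ![0, 0, 1] 2
  have e7 := E ![1, 0, 0] ![0, 1, 0] 0
  have e8 := E ![1, 0, 0] ![0, 1, 0] 1
  have e9 := E ![1, 0, 0] ![0, 1, 0] 2
  simp [torsion, cross, hmul] at e1 e2 e3 e4 e5 e6 e7 e8 e9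
  clear E hA hmul
  generalize A 0 0 = a at *
  generalize A 0 1 = b at *
  generalize A 1 0 = c at *
  generalize A 1 1 = d at *
  generalize A 2 0 = e at *
  generalize A 2 1 = f at *
  by_cases hbc : c = b
  · exfalso
    subst hbc
    by_cases hm : m = 0
    · subst hm
      have hef : e ^ 2 + f ^ 2 = 2 := by linarith
      have h1 : a * e + c * f = 0 := by linarith
      have h2 : e * c = f * a := by linarith
      have hc : c * (e ^ 2 + f ^ 2) = 0 := by linear_combination e * h2 + f * h1
      have ha : a * (e ^ 2 + f ^ 2) = 0 := by linear_combination e * h1 - f * h2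
      have hc0 : c = 0 := by rw [hef] at hc; linarith
      have ha0 : a = 0 := by rw [hef] at ha; linarith
      subst hc0 ha0
      linarith
    · have hc0 : c = 0 := by
        have : m * c = 0 := by linarith
        simpa [hm] using this
      have hda : d = a := by
        have : m * (d - a) = 0 := by linarith
        rcases mul_eq_zero.mp this with h | h
        · exact absurd h hm
        · linarith
      subst hc0 hda
      nlinarith [sq_nonneg d]
  · have hcb : c - b ≠ 0 := sub_ne_zero.mpr hbc
    have had : a + d = 0 := by
      have : (a + d) * (c - b) = 0 := by linarith
      simpa [hcb] using this
    obtain rfl : d = -a := by linarith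
    have h1 : m * (b + c) = a * (c - b) := by linarith
    have h2 : -4 * m * a = (c - b) * (b + c) := by linarith
    have hs : (b + c) * ((c - b) ^ 2 + 4 * m ^ 2) = 0 := by
      linear_combination 4 * m * h1 - (c - b) * h2
    have hpos : (c - b) ^ 2 + 4 * m ^ 2 ≠ 0 := by positivity
    have hs0 : b + c = 0 := by simpa [hpos] using hs
    obtain rfl : c = -b := by linarith
    have ha : a = 0 := by
      have : a * (-b - b) = 0 := by linarith
      simpa [hcb] using this
    subst ha
    have hb : b ^ 2 = 1 := by linarith
    have hef : e ^ 2 + f ^ 2 = 0 := by linarith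
    refine ⟨rfl, by simp, ?_, ?_, rfl, hb⟩ <;> nlinarith [sq_nonneg e, sq_nonneg f]

/-- The normal form of torsion-free endomorphisms of a single copy of su(2). -/
theorem exists_so3_of_torsion_eq_zero (K : (Fin 3 → ℝ) →ₗ[ℝ] (Fin 3 → ℝ))
    (hK : ∀ x y, torsion cross K x y = 0) :
    ∃ R, so3 R ∧ ∃ m : ℝ, ∀ x, K (R *ᵥ x) = R *ᵥ ![x 1, -(x 0), m * x 2] := by
  obtain ⟨m, v, hv, hKv⟩ := exists_unit_eigenvector (LinearMap.toMatrix' K)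
  obtain ⟨R, hR, hRv⟩ := exists_so3_col_two v hv
  set A := Rᵀ * LinearMap.toMatrix' K * R with hA
  have hconj : ∀ x, K (R *ᵥ x) = R *ᵥ (A *ᵥ x) := fun x => by
    rw [hA, ← mulVec_mulVec, ← mulVec_mulVec, hR.mulVec_transpose_mulVec,
      LinearMap.toMatrix'_mulVec]
  have htor : ∀ x y, torsion cross (A *ᵥ ·) x y = 0 := fun x y => by
    have h := torsion_map cross R.mulVecLin.toAddMonoidHom (fun x y => hR.cross_mulVec x y)
      K (A *ᵥ ·) hconj x y
    rw [hK] at h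
    have h' := congrArg (Rᵀ *ᵥ ·) h
    simpa [hR.transpose_mulVec_mulVec] using h'.symm
  have hcol : A *ᵥ ![0, 0, 1] = ![0, 0, m] := by
    rw [hA, ← mulVec_mulVec, ← mulVec_mulVec, hRv, hKv, mulVec_smul, ← hRv,
      hR.transpose_mulVec_mulVec]
    simp
  have hc := fun i => congrFun hcol i
  have h02 := hc 0
  have h12 := hc 1
  have h22 := hc 2
  simp [mulVec, dotProduct, Fin.sum_univ_three] at h02 h12 h22
  obtain ⟨h00, h11, h20, h21, h10, h01⟩ := entries_of_torsion_eq_zero h02 h12 h22 htor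
  rcases eq_or_eq_neg_of_sq_eq_sq (A 0 1) 1 (by rw [h01, one_pow]) with h | h
  · refine ⟨R, hR, m, fun x => ?_⟩
    rw [hconj]
    congr 1
    ext i
    fin_cases i <;> simp [mulVec, dotProduct, Fin.sum_univ_three, h, h00, h11, h20, h21, h10, h02, h12,
      h22]
  · have hS : so3 !![0, 1, 0; 1, 0, 0; 0, 0, -1] := by
      refine ⟨?_, by simp [det_fin_three]⟩
      ext i j
      fin_cases i <;> fin_cases j <;> simp [Matrix.mul_apply, Fin.sum_univ_three]
    refine ⟨R * !![0, 1, 0; 1, 0, 0; 0, 0, -1], hR.mul hS, m, fun x => ?_⟩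
    rw [← mulVec_mulVec, ← mulVec_mulVec, hconj]
    congr 1
    ext i
    fin_cases i <;> simp [mulVec, dotProduct, Fin.sum_univ_three, h, h00, h11, h20, h21, h10, h02, h12,
      h22]

/-- The block-diagonal action of a family of 3×3 matrices on (ℝ³)^N. -/
def blockMulVec {N : ℕ} (Φ : Fin N → Matrix (Fin 3) (Fin 3) ℝ) :
    (Fin N → Fin 3 → ℝ) →ₗ[ℝ] (Fin N → Fin 3 → ℝ) :=
  LinearMap.pi fun i => (Φ i).mulVecLin ∘ₗ LinearMap.proj i

@[simp]
theorem blockMulVec_apply {N : ℕ} (Φ : Fin N → Matrix (Fin 3) (Fin 3) ℝ)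
    (x : Fin N → Fin 3 → ℝ) (i : Fin N) : blockMulVec Φ x i = Φ i *ᵥ x i := rfl

theorem braN_blockMulVec {N : ℕ} {Φ : Fin N → Matrix (Fin 3) (Fin 3) ℝ}
    (hΦ : ∀ i, so3 (Φ i)) (x y : Fin N → Fin 3 → ℝ) :
    braN (blockMulVec Φ x) (blockMulVec Φ y) = blockMulVec Φ (braN x y) := by
  ext1 i
  exact (hΦ i).cross_mulVec (x i) (y i)

theorem blockMulVec_blockMulVec_transpose {N : ℕ} {Φ : Fin N → Matrix (Fin 3) (Fin 3) ℝ}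
    (hΦ : ∀ i, so3 (Φ i)) (x : Fin N → Fin 3 → ℝ) :
    blockMulVec Φ (blockMulVec (fun i => (Φ i)ᵀ) x) = x := by
  ext1 i
  exact (hΦ i).mulVec_transpose_mulVec (x i)

theorem blockMulVec_transpose_blockMulVec {N : ℕ} {Φ : Fin N → Matrix (Fin 3) (Fin 3) ℝ}
    (hΦ : ∀ i, so3 (Φ i)) (x : Fin N → Fin 3 → ℝ) :
    blockMulVec (fun i => (Φ i)ᵀ) (blockMulVec Φ x) = x := by
  ext1 i
  exact (hΦ i).transpose_mulVec_mulVec (x i)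

theorem torsion_JMapp {N : ℕ} (M : Matrix (Fin N) (Fin N) ℝ) (X Y : Fin N → Fin 3 → ℝ) :
    torsion braN (JMapp M) X Y = 0 := by
  have hsum : (∑ j, M · j * (X j 1 * Y j 1 + X j 0 * Y j 0)) =
      fun i => -∑ j, M i j * (-(X j 0 * Y j 0) - X j 1 * Y j 1) := by
    ext i
    rw [← Finset.sum_neg_distrib]
    exact Finset.sum_congr rfl fun j _ => by ring
  ext i k
  have h := congrFun hsum i
  fin_cases k <;> simp [torsion, braN, JMapp, cross] <;> grind

theorem cross_zero_left (x : Fin 3 → ℝ) : cross 0 x = 0 := by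
  ext i; fin_cases i <;> simp [cross]

theorem cross_zero_right (x : Fin 3 → ℝ) : cross x 0 = 0 := by
  ext i; fin_cases i <;> simp [cross]

theorem braN_single_right {N : ℕ} (x : Fin N → Fin 3 → ℝ) (j : Fin N) (y : Fin 3 → ℝ) :
    braN x (Pi.single j y) = Pi.single j (cross (x j) y) := by
  ext1 i
  by_cases h : i = j
  · subst h; simp [braN]
  · simp [braN, h, cross_zero_right]

theorem braN_single_left {N : ℕ} (x : Fin 3 → ℝ) (j : Fin N) (y : Fin N → Fin 3 → ℝ) :
    braN (Pi.single j x) y = Pi.single j (cross x (y j)) := by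
  ext1 i
  by_cases h : i = j
  · subst h; simp [braN]
  · simp [braN, h, cross_zero_left]

/-- An off-diagonal block kills the first two basis vectors once the diagonal block of its
column is in normal form. -/
theorem eq_zero_of_cross_eq (A : (Fin 3 → ℝ) →ₗ[ℝ] (Fin 3 → ℝ)) (m : ℝ)
    (hA : ∀ x y, cross (A x) (A y) =
      A (cross ![x 1, -(x 0), m * x 2] y) + A (cross x ![y 1, -(y 0), m * y 2])) :
    A ![1, 0, 0] = 0 ∧ A ![0, 1, 0] = 0 := by
  have h02 : cross (A ![1, 0, 0]) (A ![0, 0, 1]) = -A ![1, 0, 0] - m • A ![0, 1, 0] := by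
    rw [hA, ← map_smul, ← map_neg, ← map_sub, ← map_add]
    congr 1
    ext i
    fin_cases i <;> simp [cross]
  have h12 : cross (A ![0, 1, 0]) (A ![0, 0, 1]) = m • A ![1, 0, 0] - A ![0, 1, 0] := by
    rw [hA, ← map_smul, ← map_sub, ← map_add]
    congr 1
    ext i
    fin_cases i <;> simp [cross]
  generalize A ![1, 0, 0] = a at *
  generalize A ![0, 1, 0] = b at *
  generalize A ![0, 0, 1] = c at *
  have a0 := congrFun h02 0
  have a1 := congrFun h02 1
  have a2 := congrFun h02 2
  have b0 := congrFun h12 0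
  have b1 := congrFun h12 1
  have b2 := congrFun h12 2
  simp [cross] at a0 a1 a2 b0 b1 b2
  have hsum : a 0 ^ 2 + a 1 ^ 2 + a 2 ^ 2 + (b 0 ^ 2 + b 1 ^ 2 + b 2 ^ 2) = 0 := by
    linear_combination a 0 * a0 + a 1 * a1 + a 2 * a2 + b 0 * b0 + b 1 * b1 + b 2 * b2
  constructor <;> ext i <;> fin_cases i <;> simp <;>
    nlinarith [sq_nonneg (a 0), sq_nonneg (a 1), sq_nonneg (a 2), sq_nonneg (b 0),
      sq_nonneg (b 1), sq_nonneg (b 2)]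

/-- A torsion-free `J` whose diagonal blocks are in normal form is in normal form. -/
theorem eq_JMapp_of_diagonal_blocks {N : ℕ}
    (J : (Fin N → Fin 3 → ℝ) →ₗ[ℝ] (Fin N → Fin 3 → ℝ))
    (hJ : ∀ X Y, torsion braN J X Y = 0) (m : Fin N → ℝ)
    (hdiag : ∀ i x, J (Pi.single i x) i = ![x 1, -(x 0), m i * x 2]) :
    ∃ M : Matrix (Fin N) (Fin N) ℝ, ∀ x, J x = JMapp M x := by
  have hker : ∀ i j, i ≠ j →
      J (Pi.single j ![1, 0, 0]) i = 0 ∧ J (Pi.single j ![0, 1, 0]) i = 0 := fun i j hij => by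
    refine eq_zero_of_cross_eq (LinearMap.proj i ∘ₗ J ∘ₗ LinearMap.single ℝ (fun _ => Fin 3 → ℝ) j) (m j) ?_
    intro x y
    have h := congrFun (hJ (Pi.single j x) (Pi.single j y)) i
    simp only [torsion, braN_single_left, braN_single_right, hdiag, Pi.sub_apply,
      Pi.single_eq_same, Pi.single_eq_of_ne hij, Pi.zero_apply, sub_zero] at h
    rw [sub_sub, sub_eq_zero] at h
    exact h
  have himg : ∀ i j, i ≠ j →
      J (Pi.single j ![0, 0, 1]) i 0 = 0 ∧ J (Pi.single j ![0, 0, 1]) i 1 = 0 := fun i j hij => by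
    have h : ∀ y, J (Pi.single i y) j = 0 →
        cross (J (Pi.single j ![0, 0, 1]) i) (J (Pi.single i y) i) =
          J (Pi.single i (cross (J (Pi.single j ![0, 0, 1]) i) y)) i := fun y hy => by
      have h := congrFun (hJ (Pi.single j ![0, 0, 1]) (Pi.single i y)) i
      simp only [torsion, braN_single_left, braN_single_right, hy, cross_zero_right,
        Pi.single_zero, map_zero, Pi.sub_apply, Pi.zero_apply, sub_zero,
        Pi.single_eq_of_ne hij, cross_zero_left] at h
      exact sub_eq_zero.mp h
    have h0 := congrFun (h _ (hker j i hij.symm).1) 2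
    have h1 := congrFun (h _ (hker j i hij.symm).2) 2
    rw [hdiag, hdiag] at h0 h1
    simp [cross] at h0 h1
    generalize J (Pi.single j ![0, 0, 1]) i = c at *
    have hp : c 0 * (1 + m i ^ 2) = 0 := by linear_combination h0 - m i * h1
    have hq : c 1 * (1 + m i ^ 2) = 0 := by linear_combination (-1) * h1 - m i * h0
    have hm : 1 + m i ^ 2 ≠ 0 := by positivity
    simpa [hm] using And.intro hp hq
  refine ⟨fun i j => J (Pi.single j ![0, 0, 1]) i 2, fun x => ?_⟩
  have hblock : ∀ i j, J (Pi.single j (x j)) i =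
      ![if i = j then x i 1 else 0, if i = j then -(x i 0) else 0,
        J (Pi.single j ![0, 0, 1]) i 2 * x j 2] := fun i j => by
    by_cases hij : i = j
    · subst hij
      rw [hdiag, hdiag]
      simp
    · have hx : x j = x j 0 • ![1, 0, 0] + x j 1 • ![0, 1, 0] + x j 2 • ![0, 0, 1] := by
        ext k
        fin_cases k <;> simp
      conv_lhs => rw [hx]
      rw [Pi.single_add, Pi.single_add, Pi.single_smul, Pi.single_smul, Pi.single_smul,
        map_add, map_add, map_smul, map_smul, map_smul]
      ext k
      fin_cases k <;> simp [hker i j hij, himg i j hij, hij, mul_comm]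
  ext i k
  conv_lhs => rw [← Finset.univ_sum_single x, map_sum, Finset.sum_apply, Finset.sum_apply]
  simp only [hblock]
  fin_cases k <;> simp [JMapp]

/-- A linear map J : su(2)^N → su(2)^N has zero torsion iff there exist
Φ ∈ SO(3)^N (acting block-diagonally) and a real N×N matrix M with Φ⁻¹ J Φ = J(M),
i.e. J ∘ Φ = Φ ∘ J(M). -/
theorem stmt14 {N : ℕ} (hN : 1 ≤ N)
    (J : (Fin N → Fin 3 → ℝ) →ₗ[ℝ] (Fin N → Fin 3 → ℝ)) :
    (∀ X Y : Fin N → Fin 3 → ℝ,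
        braN (J X) (J Y) - braN X Y - J (braN (J X) Y) - J (braN X (J Y)) = 0) ↔
      ∃ (Φ : Fin N → Matrix (Fin 3) (Fin 3) ℝ) (M : Matrix (Fin N) (Fin N) ℝ),
        (∀ i, so3 (Φ i)) ∧
        ∀ x : Fin N → Fin 3 → ℝ,
          J (fun i => (Φ i).mulVec (x i)) = fun i => (Φ i).mulVec (JMapp M x i) := by
  constructor
  · intro hJ
    have hdiag : ∀ i, ∃ R, so3 R ∧ ∃ m : ℝ, ∀ x,
        J (Pi.single i (R *ᵥ x)) i = R *ᵥ ![x 1, -(x 0), m * x 2] := fun i => by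
      refine exists_so3_of_torsion_eq_zero
        (LinearMap.proj i ∘ₗ J ∘ₗ LinearMap.single ℝ (fun _ => Fin 3 → ℝ) i) fun x y => ?_
      have h := congrFun (hJ (Pi.single i x) (Pi.single i y)) i
      simp only [braN_single_left, braN_single_right] at h
      simpa [torsion, braN] using h
    choose Φ hΦ m hm using hdiag
    set J' := blockMulVec (fun i => (Φ i)ᵀ) ∘ₗ J ∘ₗ blockMulVec Φ with hJ'
    have hconj : ∀ x, J (blockMulVec Φ x) = blockMulVec Φ (J' x) := fun x => by
      simp only [hJ', LinearMap.comp_apply, blockMulVec_blockMulVec_transpose hΦ]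
    have htor : ∀ X Y, torsion braN J' X Y = 0 := fun X Y => by
      have h := torsion_map braN (blockMulVec Φ).toAddMonoidHom
        (fun x y => braN_blockMulVec hΦ x y) J J' hconj X Y
      have h0 : torsion braN J (blockMulVec Φ X) (blockMulVec Φ Y) = 0 := hJ _ _
      have h' := congrArg (blockMulVec fun i => (Φ i)ᵀ) (h.symm.trans h0)
      simpa [blockMulVec_transpose_blockMulVec hΦ] using h'
    obtain ⟨M, hM⟩ := eq_JMapp_of_diagonal_blocks J' htor m fun i x => by
      have hs : blockMulVec Φ (Pi.single i x) = Pi.single i (Φ i *ᵥ x) := by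
        ext1 j
        by_cases h : j = i
        · subst h; simp
        · simp [h]
      simp only [hJ', LinearMap.comp_apply, hs, blockMulVec_apply, hm,
        (hΦ i).transpose_mulVec_mulVec]
    exact ⟨Φ, M, hΦ, fun x => (hconj x).trans (by rw [hM]; rfl)⟩
  · rintro ⟨Φ, M, hΦ, hJ⟩ X Y
    have h := torsion_map braN (blockMulVec Φ).toAddMonoidHom
      (fun x y => braN_blockMulVec hΦ x y) J (JMapp M) hJ
      (blockMulVec (fun i => (Φ i)ᵀ) X) (blockMulVec (fun i => (Φ i)ᵀ) Y)
    rw [torsion_JMapp, map_zero] at h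
    simpa [blockMulVec_blockMulVec_transpose hΦ, torsion] using h
end

section
/- Let N be even. Every complex structure on su(2)^N is conjugate under some element of SO(3)^N to J(M) for some real N×N matrix M with M² = −I_N. Moreover J(M) and J(M′) (with M² = M′² = −I_N) are conjugate under some element of SO(3)^N if and only if M′ = M; and for a permutation σ of {1,…,N} with associated block-permutation operator τ_σ on (ℝ³)^N (block (i,j) equal to δ_{i,σ(j)} I₃), J(M′) is conjugate to J(M) under some element of τ_σ(SO(3)^N) if and only if M′ = (m_{σ⁻¹(i),σ⁻¹(j)})_{i,j}. -/
/-- `J` is a complex structure on su(2)^N: `J² = −id` and zero torsion. -/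
def isCxN {N : ℕ} (J : (Fin N → Fin 3 → ℝ) →ₗ[ℝ] (Fin N → Fin 3 → ℝ)) : Prop :=
  (∀ X, J (J X) = -X) ∧
    ∀ X Y : Fin N → Fin 3 → ℝ,
      braN (J X) (J Y) - braN X Y - J (braN (J X) Y) - J (braN X (J Y)) = 0

/-- The block-diagonal action of Φ ∈ SO(3)^N on (ℝ³)^N. -/
def blockApp {N : ℕ} (Φ : Fin N → Matrix (Fin 3) (Fin 3) ℝ) (x : Fin N → Fin 3 → ℝ) :
    Fin N → Fin 3 → ℝ :=
  fun i => (Φ i).mulVec (x i)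

/-- The block-permutation operator τ_σ (block (i,j) equal to δ_{i,σ(j)} I₃). -/
def tauPerm {N : ℕ} (σ : Equiv.Perm (Fin N)) (x : Fin N → Fin 3 → ℝ) :
    Fin N → Fin 3 → ℝ :=
  fun i => x (σ⁻¹ i)

open scoped Matrix

namespace ComplexStructure

/-- A subspace of `ℂ³` stable under all cross products is trivial: `sl₂(ℂ)` is simple. -/
lemma ideal_eq_bot_or_top (K : Submodule ℂ (Fin 3 → ℂ)) (h : ∀ v, ∀ x ∈ K, v ⨯₃ x ∈ K) :
    K = ⊥ ∨ K = ⊤ := by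
  refine or_iff_not_imp_left.2 fun hK => ?_
  obtain ⟨x, hx, hx0⟩ := (Submodule.ne_bot_iff K).1 hK
  obtain ⟨k, hk⟩ := Function.ne_iff.1 hx0
  refine (Submodule.eq_top_iff').2 fun b => ?_
  have key : x k • b ∈ K := by
    have e : x k • b
        = Pi.single k 1 ⨯₃ (b ⨯₃ x) + (Pi.single k 1 ⬝ᵥ b) • x := by
      rw [cross_cross_eq_smul_sub_smul']
      simp [dotProduct_comm]
    rw [e]
    exact K.add_mem (h _ _ (h _ _ hx)) (K.smul_mem _ hx)
  simpa [smul_smul, inv_mul_cancel₀ hk] using K.smul_mem (x k)⁻¹ key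

/-- An injective endomorphism of `(ℂ³, ×)` is given by a complex orthogonal matrix. -/
lemma transpose_mul_self_of_cross (F : Matrix (Fin 3) (Fin 3) ℂ)
    (hF : ∀ a b, F *ᵥ (a ⨯₃ b) = (F *ᵥ a) ⨯₃ (F *ᵥ b)) (hdet : F.det ≠ 0) :
    Fᵀ * F = 1 := by
  have h01 := hF (Pi.single 0 1) (Pi.single 1 1)
  have h12 := hF (Pi.single 1 1) (Pi.single 2 1)
  have h20 := hF (Pi.single 2 1) (Pi.single 0 1)
  simp [cross_apply, funext_iff, Fin.forall_fin_succ, Matrix.mulVec, dotProduct,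
    Fin.sum_univ_three] at h01 h12 h20
  obtain ⟨a0, a1, a2⟩ := h01
  obtain ⟨b0, b1, b2⟩ := h12
  obtain ⟨c0, c1, c2⟩ := h20
  have key : Fᵀ * F = F.det • (1 : Matrix (Fin 3) (Fin 3) ℂ) := by
    ext i j
    rw [Matrix.det_fin_three]
    fin_cases i <;> fin_cases j <;>
      simp [Matrix.mul_apply, Fin.sum_univ_three] <;> grind
  have hd := congrArg Matrix.det key
  rw [Matrix.det_mul, Matrix.det_transpose, Matrix.det_smul, Matrix.det_one] at hd
  have h1 : F.det = 1 := by
    simp only [Fintype.card_fin, mul_one] at hd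
    have : F.det * F.det * (F.det - 1) = 0 := by linear_combination -hd
    simpa [hdet, sub_eq_zero] using this
  rw [key, h1, one_smul]

/-- The imaginary part of a complex orthogonal `3 × 3` matrix is singular. -/
lemma det_im_eq_zero (F : Matrix (Fin 3) (Fin 3) ℂ) (hF : Fᵀ * F = 1) :
    (F.map Complex.im).det = 0 := by
  set P := F.map Complex.re with hP
  set Q := F.map Complex.im with hQ
  have hre : Pᵀ * P = 1 + Qᵀ * Q := by
    ext i j
    have := congrArg Complex.re (congrFun (congrFun hF i) j)
    have h1 : ((1 : Matrix (Fin 3) (Fin 3) ℂ) i j).re = (1 : Matrix (Fin 3) (Fin 3) ℝ) i j := by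
      by_cases h : i = j <;> simp [Matrix.one_apply, h]
    simp [Matrix.mul_apply, Fin.sum_univ_three, h1] at this
    simp [Matrix.mul_apply, Fin.sum_univ_three, hP, hQ]
    linarith
  have him : (Pᵀ * Q)ᵀ = -(Pᵀ * Q) := by
    ext i j
    have := congrArg Complex.im (congrFun (congrFun hF i) j)
    have h1 : ((1 : Matrix (Fin 3) (Fin 3) ℂ) i j).im = 0 := by
      by_cases h : i = j <;> simp [Matrix.one_apply, h]
    simp [Matrix.mul_apply, Fin.sum_univ_three, h1] at this
    simp [Matrix.mul_apply, Fin.sum_univ_three, hP, hQ]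
    linarith
  have hPQ : P.det * Q.det = 0 := by
    have h := congrArg Matrix.det him
    rw [Matrix.det_transpose, Matrix.det_neg, Matrix.det_mul, Matrix.det_transpose] at h
    simp only [Fintype.card_fin] at h
    linarith
  refine (mul_eq_zero.1 hPQ).resolve_left fun h0 => ?_
  obtain ⟨v, hv, hv0⟩ := Matrix.exists_mulVec_eq_zero_iff.2 h0
  have h := congrArg (fun A => v ⬝ᵥ (A *ᵥ v)) hre
  simp only [← Matrix.mulVec_mulVec, hv0, Matrix.mulVec_zero, dotProduct_zero, Matrix.add_mulVec,
    Matrix.one_mulVec, dotProduct_add, Matrix.dotProduct_mulVec, Matrix.vecMul_transpose] at h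
  rw [← Matrix.dotProduct_mulVec] at h
  have h1 : 0 ≤ Q *ᵥ v ⬝ᵥ Q *ᵥ v := Finset.sum_nonneg fun _ _ => mul_self_nonneg _
  have h2 : 0 ≤ v ⬝ᵥ v := Finset.sum_nonneg fun _ _ => mul_self_nonneg _
  exact hv (dotProduct_self_eq_zero.1 (by linarith))

variable {N : ℕ}

/-- The vector `X - iJX`. -/
def zeta (J : (Fin N → Fin 3 → ℝ) →ₗ[ℝ] (Fin N → Fin 3 → ℝ)) (X : Fin N → Fin 3 → ℝ) :
    Fin N → Fin 3 → ℂ :=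
  fun i k => ⟨X i k, -(J X i k)⟩

variable {J : (Fin N → Fin 3 → ℝ) →ₗ[ℝ] (Fin N → Fin 3 → ℝ)}

lemma smul_zeta (hJ : isCxN J) (c : ℂ) (X : Fin N → Fin 3 → ℝ) :
    c • zeta J X = zeta J (c.re • X + c.im • J X) := by
  ext i k
  apply Complex.ext <;> simp [zeta, hJ.1]
  ring

/-- The `i`-eigenspace of `J` in the complexification `(ℂ³)^N`. -/
def holo (hJ : isCxN J) : Submodule ℂ (Fin N → Fin 3 → ℂ) where
  carrier := Set.range (zeta J)
  add_mem' := by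
    rintro _ _ ⟨X, rfl⟩ ⟨Y, rfl⟩
    refine ⟨X + Y, ?_⟩
    ext i k
    apply Complex.ext <;> simp [zeta]
    ring
  zero_mem' := ⟨0, by ext i k; apply Complex.ext <;> simp [zeta]⟩
  smul_mem' := by
    rintro c _ ⟨X, rfl⟩
    exact ⟨_, (smul_zeta hJ c X).symm⟩

lemma zeta_mem (hJ : isCxN J) (X : Fin N → Fin 3 → ℝ) : zeta J X ∈ holo hJ := ⟨X, rfl⟩

/-- Zero torsion makes the eigenspace a subalgebra. -/
lemma cross_mem (hJ : isCxN J) {z w : Fin N → Fin 3 → ℂ} (hz : z ∈ holo hJ)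
    (hw : w ∈ holo hJ) : (fun i => z i ⨯₃ w i) ∈ holo hJ := by
  obtain ⟨X, rfl⟩ := hz
  obtain ⟨Y, rfl⟩ := hw
  refine ⟨braN X Y - braN (J X) (J Y), ?_⟩
  have h : J (braN X Y - braN (J X) (J Y)) = braN (J X) Y + braN X (J Y) := by
    have e : braN X Y - braN (J X) (J Y) = -J (braN (J X) Y + braN X (J Y)) := by
      have := hJ.2 X Y
      rw [map_add]
      linear_combination -this
    rw [e, map_neg, hJ.1, neg_neg]
  ext i k
  apply Complex.ext
  · fin_cases k <;> simp [zeta, braN, cross, cross_apply] <;> ring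
  · simp only [zeta, h]
    fin_cases k <;> simp [zeta, braN, cross, cross_apply] <;> ring

/-- If the eigenspace surjects onto the factor `i`, its projection to that factor does not factor
through its projection to another factor `j`. -/
lemma exists_ne_zero_of_surjective (hJ : isCxN J) {i j : Fin N} (hij : j ≠ i)
    (hi : ∀ y, ∃ z ∈ holo hJ, z i = y) : ∃ z ∈ holo hJ, z j = 0 ∧ z i ≠ 0 := by
  by_contra! hker
  let f : holo hJ →ₗ[ℂ] (Fin 3 → ℂ) := LinearMap.proj i ∘ₗ (holo hJ).subtype
  have hf : LinearMap.range f = ⊤ := LinearMap.range_eq_top.2 fun y => by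
    obtain ⟨z, hz, e⟩ := hi y
    exact ⟨⟨z, hz⟩, e⟩
  obtain ⟨s, hs⟩ := f.exists_rightInverse_of_surjective hf
  have hs' : ∀ y, (s y : Fin N → Fin 3 → ℂ) i = y := fun y => LinearMap.congr_fun hs y
  let G : (Fin 3 → ℂ) →ₗ[ℂ] (Fin 3 → ℂ) := LinearMap.proj j ∘ₗ (holo hJ).subtype ∘ₗ s
  have hG : Function.Injective G := (injective_iff_map_eq_zero G).2 fun y hy => by
    rw [← hs' y]
    exact hker _ (s y).2 hy
  let E := LinearEquiv.ofInjectiveEndo G hG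
  have hGE : ∀ y, (s (E.symm y) : Fin N → Fin 3 → ℂ) j = y := fun y => E.apply_symm_apply y
  have hE : ∀ z ∈ holo hJ, E.symm (z j) = z i := fun z hz => by
    have h := hker _ ((holo hJ).sub_mem hz (s (E.symm (z j))).2) (by simp [hGE])
    rw [Pi.sub_apply, hs', sub_eq_zero] at h
    exact h.symm
  have hcross : ∀ a b, E.symm (a ⨯₃ b) = E.symm a ⨯₃ E.symm b := fun a b => by
    have h := hE _ (cross_mem hJ (s (E.symm a)).2 (s (E.symm b)).2)
    simpa only [hGE, hs'] using h
  set F := LinearMap.toMatrix' (E.symm : (Fin 3 → ℂ) →ₗ[ℂ] (Fin 3 → ℂ)) with hFdef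
  have hFa : ∀ a, F *ᵥ a = E.symm a := fun a => by simp [hFdef, LinearMap.toMatrix'_mulVec]
  have hdet : F.det ≠ 0 := by
    intro h0
    obtain ⟨v, hv, hv0⟩ := Matrix.exists_mulVec_eq_zero_iff.2 h0
    rw [hFa] at hv0
    exact hv (by simpa using hv0)
  have horth := transpose_mul_self_of_cross F (fun a b => by simp only [hFa, hcross]) hdet
  obtain ⟨l, hl, hl0⟩ := Matrix.exists_vecMul_eq_zero_iff.2 (det_im_eq_zero F horth)
  set X : Fin N → Fin 3 → ℝ := Pi.single i l with hX
  have hXi := hE _ (zeta_mem hJ X)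
  rw [← hFa] at hXi
  have hre : F.map Complex.im *ᵥ (J X j) = l := by
    ext k
    have := congrArg Complex.re (congrFun hXi k)
    simpa [Matrix.mulVec, dotProduct, zeta, hX, Pi.single_eq_of_ne hij] using this
  apply hl
  rw [← dotProduct_self_eq_zero]
  nth_rewrite 2 [← hre]
  rw [Matrix.dotProduct_mulVec, hl0, zero_dotProduct]

/-- The eigenspace does not surject onto any factor. -/
lemma not_surjective (hJ : isCxN J) (i : Fin N) : ¬ ∀ y, ∃ z ∈ holo hJ, z i = y := by
  intro hi
  have hone : ∀ j, j ≠ i → ∀ y, ∃ z ∈ holo hJ, z j = 0 ∧ z i = y := fun j hij => by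
    let pr (k : Fin N) : (Fin N → Fin 3 → ℂ) →ₗ[ℂ] (Fin 3 → ℂ) := LinearMap.proj k
    let K := (holo hJ ⊓ LinearMap.ker (pr j)).map (pr i)
    have hK : K = ⊤ := by
      refine (ideal_eq_bot_or_top K ?_).resolve_left ?_
      · rintro v _ ⟨z, ⟨hz, hzj⟩, rfl⟩
        obtain ⟨w, hw, rfl⟩ := hi v
        have hzj' : z j = 0 := hzj
        exact ⟨_, ⟨cross_mem hJ hw hz, by simp [pr, hzj']⟩, rfl⟩
      · obtain ⟨z, hz, hzj, hzi⟩ := exists_ne_zero_of_surjective hJ hij hi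
        exact (Submodule.ne_bot_iff K).2 ⟨z i, ⟨z, ⟨hz, hzj⟩, rfl⟩, hzi⟩
    intro y
    obtain ⟨z, ⟨hz, hzj⟩, h⟩ : y ∈ K := hK ▸ Submodule.mem_top
    exact ⟨z, hz, hzj, h⟩
  have hall : ∀ A : Finset (Fin N), i ∉ A →
      ∀ y, ∃ z ∈ holo hJ, (∀ j ∈ A, z j = 0) ∧ z i = y := fun A => by
    induction A using Finset.induction_on with
    | empty => exact fun _ y => by simpa using hi y
    | insert j A hj ih =>
      intro hiA
      have hji : j ≠ i := fun h => hiA (h ▸ Finset.mem_insert_self j A)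
      have ih := ih fun h => hiA (Finset.mem_insert_of_mem h)
      have hbr : ∀ a b, ∃ z ∈ holo hJ, (∀ k ∈ insert j A, z k = 0) ∧ z i = a ⨯₃ b := fun a b => by
        obtain ⟨z, hz, hzA, rfl⟩ := ih a
        obtain ⟨w, hw, hwj, rfl⟩ := hone j hji b
        refine ⟨_, cross_mem hJ hz hw, fun k hk => ?_, rfl⟩
        rcases Finset.mem_insert.1 hk with rfl | hk
        · simp [hwj]
        · simp [hzA k hk]
      intro y
      obtain ⟨z, hz, hzA, hzi⟩ := hbr ![0, y 0, 0] ![0, 0, 1]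
      obtain ⟨w, hw, hwA, hwi⟩ := hbr ![1, 0, 0] ![0, y 2, -y 1]
      refine ⟨z + w, (holo hJ).add_mem hz hw, fun k hk => by simp [hzA k hk, hwA k hk], ?_⟩
      ext k
      fin_cases k <;> simp [hzi, hwi, cross_apply]
  obtain ⟨_, ⟨X, rfl⟩, h0, h1⟩ := hall {i}ᶜ (by simp) (Pi.single 0 1)
  have hJX : J X = 0 := by
    ext j k
    by_cases hj : j = i
    · subst hj
      have := congrArg Complex.im (congrFun h1 k)
      fin_cases k <;> simpa [zeta] using this
    · simpa [zeta] using congrArg Complex.im (congrFun (h0 j (by simpa using hj)) k)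
  have h := hJ.1 X
  rw [hJX, map_zero] at h
  have hX : X = 0 := neg_eq_zero.1 h.symm
  simpa [zeta, hX] using congrArg Complex.re (congrFun h1 0)

/-- The projection of the eigenspace to a factor is orthogonal to some nonzero vector. -/
lemma exists_orthogonal (hJ : isCxN J) (i : Fin N) :
    ∃ n : Fin 3 → ℂ, n ≠ 0 ∧ ∀ z ∈ holo hJ, n ⬝ᵥ z i = 0 := by
  let p : Submodule ℂ (Fin 3 → ℂ) := (holo hJ).map (LinearMap.proj i)
  have hp : p < ⊤ := lt_top_iff_ne_top.2 fun h => not_surjective hJ i fun y => by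
    obtain ⟨z, hz, e⟩ : y ∈ p := h ▸ Submodule.mem_top
    exact ⟨z, hz, e⟩
  obtain ⟨f, hf, hle⟩ := p.exists_le_ker_of_lt_top hp
  have hfa : ∀ y, (fun k => f fun j => if k = j then 1 else 0) ⬝ᵥ y = f y := fun y => by
    rw [LinearMap.pi_apply_eq_sum_univ f y]
    simp [dotProduct, mul_comm]
  refine ⟨fun k => f fun j => if k = j then 1 else 0,
    fun h => hf (LinearMap.ext fun y => ?_), fun z hz => ?_⟩
  · rw [← hfa y, h, zero_dotProduct, LinearMap.zero_apply]
  · rw [hfa]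
    exact hle ⟨z, hz, rfl⟩

/-- On every factor `J` acts on a plane of covectors as a rotation by a right angle. -/
lemma exists_rotated_plane (hJ : isCxN J) (i : Fin N) :
    ∃ u v : Fin 3 → ℝ, u ⬝ᵥ u = 1 ∧ v ⬝ᵥ v = 1 ∧ u ⬝ᵥ v = 0 ∧
      ∀ X, u ⬝ᵥ J X i = v ⬝ᵥ X i ∧ v ⬝ᵥ J X i = -(u ⬝ᵥ X i) := by
  obtain ⟨n, hn, hperp⟩ := exists_orthogonal hJ i
  set u : Fin 3 → ℝ := fun k => (n k).re with hu
  set v : Fin 3 → ℝ := fun k => (n k).im with hv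
  have hrot : ∀ X, u ⬝ᵥ J X i = v ⬝ᵥ X i ∧ v ⬝ᵥ J X i = -(u ⬝ᵥ X i) := fun X => by
    have h := hperp _ (zeta_mem hJ X)
    have hre := congrArg Complex.re h
    have him := congrArg Complex.im h
    simp [dotProduct, Fin.sum_univ_three, zeta] at hre him
    simp only [dotProduct, Fin.sum_univ_three, hu, hv]
    constructor <;> linarith
  have hrot_single : ∀ x, u ⬝ᵥ J (Pi.single i x) i = v ⬝ᵥ x ∧
      v ⬝ᵥ J (Pi.single i x) i = -(u ⬝ᵥ x) := fun x => by
    simpa using hrot (Pi.single i x)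
  have hu0 : u ≠ 0 := fun h => hn <| by
    have hv0 : v ⬝ᵥ v = 0 := by simpa [h] using (hrot_single v).1.symm
    rw [dotProduct_self_eq_zero] at hv0
    ext k
    exact Complex.ext (congrFun h k) (congrFun hv0 k)
  have hv0 : v ≠ 0 := fun h => hu0 <| by
    have : u ⬝ᵥ u = 0 := by simpa [h] using (hrot_single u).2.symm
    rwa [dotProduct_self_eq_zero] at this
  set w : Fin 3 → ℝ := u ⨯₃ v with hw
  have hw0 : w ⬝ᵥ w ≠ 0 := fun h => by
    have hpar : v ⨯₃ w = 0 := by rw [dotProduct_self_eq_zero.1 h]; simp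
    rw [hw, cross_cross_eq_smul_sub_smul'] at hpar
    obtain ⟨h1, h2⟩ := hrot_single v
    have := congrArg (· ⬝ᵥ J (Pi.single i v) i) hpar
    simp only [sub_dotProduct, smul_dotProduct, h1, h2, zero_dotProduct, smul_eq_mul] at this
    have hvv : v ⬝ᵥ v ≠ 0 := fun h => hv0 (dotProduct_self_eq_zero.1 h)
    have := mul_self_pos.2 hvv
    nlinarith [mul_self_nonneg (u ⬝ᵥ v), dotProduct_comm u v]
  obtain ⟨z, hz, hzi⟩ : ∃ z ∈ holo hJ, z i = fun k => (w k : ℂ) := by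
    obtain ⟨h1, h2⟩ := hrot_single w
    set c := J (Pi.single i w) i with hc
    have hcw : (w ⬝ᵥ w) • c = (w ⬝ᵥ c) • w := by
      have h := cross_cross_eq_smul_sub_smul' w c w
      have hvw : v ⬝ᵥ w = 0 := dot_cross_self u v
      have huw : u ⬝ᵥ w = 0 := dot_self_cross u v
      have h' : c ⨯₃ w = 0 := by
        rw [hw, cross_cross_eq_smul_sub_smul', dotProduct_comm c v, h2, h1, hvw, huw]
        simp
      rw [h', map_zero, dotProduct_comm c w] at h
      exact sub_eq_zero.1 h.symm
    set s : ℂ := ⟨w ⬝ᵥ w, -(w ⬝ᵥ c)⟩ with hs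
    have hs0 : s ≠ 0 := fun h => hw0 (congrArg Complex.re h)
    refine ⟨(s⁻¹ * (w ⬝ᵥ w : ℝ)) • zeta J (Pi.single i w),
      (holo hJ).smul_mem _ (zeta_mem hJ _), funext fun k => ?_⟩
    have hk := congrFun hcw k
    simp only [Pi.smul_apply, smul_eq_mul] at hk
    rw [Pi.smul_apply, Pi.smul_apply, smul_eq_mul, mul_assoc, inv_mul_eq_iff_eq_mul₀ hs0]
    apply Complex.ext
    · simp [zeta, hs]
    · simp [zeta, hs, ← hc, hk]
  have hperp_u := hperp _ (cross_mem hJ hz (zeta_mem hJ (Pi.single i u)))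
  obtain ⟨h1, h2⟩ := hrot_single u
  have hre := congrArg Complex.re hperp_u
  have him := congrArg Complex.im hperp_u
  simp [hzi, hw, cross_apply, zeta, dotProduct, Fin.sum_univ_three] at hre him
  simp only [show ∀ k, (n k).re = u k from fun _ => rfl,
    show ∀ k, (n k).im = v k from fun _ => rfl] at hre him
  set d := J (Pi.single i u) i
  have huu : 0 < u ⬝ᵥ u := lt_of_le_of_ne (Finset.sum_nonneg fun _ _ => mul_self_nonneg _)
    fun h => hu0 (dotProduct_self_eq_zero.1 h.symm)
  have hvv : 0 ≤ v ⬝ᵥ v := Finset.sum_nonneg fun _ _ => mul_self_nonneg _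
  have huv : u ⬝ᵥ v = 0 := by
    have : (u ⬝ᵥ v) * (u ⬝ᵥ u + v ⬝ᵥ v) = 0 := by
      simp only [dotProduct, Fin.sum_univ_three] at h1 h2 ⊢
      linear_combination hre - (v 0 * v 0 + v 1 * v 1 + v 2 * v 2) * h1
        + (u 0 * v 0 + u 1 * v 1 + u 2 * v 2) * h2
    exact (mul_eq_zero.1 this).resolve_right (by positivity)
  have huv' : v ⬝ᵥ v = u ⬝ᵥ u := by
    have : (u ⬝ᵥ u) * (v ⬝ᵥ v - u ⬝ᵥ u) = 2 * (u ⬝ᵥ v) ^ 2 := by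
      simp only [dotProduct, Fin.sum_univ_three] at h1 h2 ⊢
      linear_combination him + (u 0 * v 0 + u 1 * v 1 + u 2 * v 2) * h1
        - (u 0 * u 0 + u 1 * u 1 + u 2 * u 2) * h2
    rw [huv] at this
    have := (mul_eq_zero.1 (this.trans (by simp))).resolve_left huu.ne'
    linarith
  set r := (Real.sqrt (u ⬝ᵥ u))⁻¹ with hr
  have hr2 : r * (r * (u ⬝ᵥ u)) = 1 := by
    rw [hr, ← mul_assoc, ← mul_inv, Real.mul_self_sqrt huu.le, inv_mul_cancel₀ huu.ne']
  refine ⟨r • u, r • v, ?_, ?_, ?_, fun X => ?_⟩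
  · simpa [smul_dotProduct, dotProduct_smul] using hr2
  · simpa [smul_dotProduct, dotProduct_smul, huv'] using hr2
  · simp [smul_dotProduct, dotProduct_smul, huv]
  · simp [smul_dotProduct, hrot X]

/-- Rotations preserve the cross product. -/
lemma so3_mulVec_cross {R : Matrix (Fin 3) (Fin 3) ℝ} (hR : so3 R) (a b : Fin 3 → ℝ) :
    R *ᵥ cross a b = cross (R *ᵥ a) (R *ᵥ b) := by
  have hadj : R.adjugate = Rᵀ := by
    calc R.adjugate = R.adjugate * (R * Rᵀ) := by rw [hR.1, mul_one]
      _ = Rᵀ := by rw [← mul_assoc, Matrix.adjugate_mul, hR.2, one_smul, one_mul]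
  have h : ∀ i j, R j i = R.adjugate i j := fun i j => by rw [hadj]; rfl
  rw [Matrix.adjugate_fin_three] at h
  ext k
  fin_cases k <;> simp [Matrix.mulVec, dotProduct, Fin.sum_univ_three, cross]
  · rw [h 0 0, h 1 0, h 2 0]; simp; ring
  · rw [h 0 1, h 1 1, h 2 1]; simp; ring
  · rw [h 0 2, h 1 2, h 2 2]; simp; ring

lemma so3_transpose {R : Matrix (Fin 3) (Fin 3) ℝ} (hR : so3 R) : so3 Rᵀ :=
  ⟨by rw [Matrix.transpose_transpose]; exact mul_eq_one_comm.1 hR.1,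
    by rw [Matrix.det_transpose, hR.2]⟩

/-- `blockApp` as a linear map. -/
def blockLin (Φ : Fin N → Matrix (Fin 3) (Fin 3) ℝ) :
    (Fin N → Fin 3 → ℝ) →ₗ[ℝ] (Fin N → Fin 3 → ℝ) :=
  LinearMap.pi fun i => (Φ i).mulVecLin ∘ₗ LinearMap.proj i

lemma blockLin_apply (Φ : Fin N → Matrix (Fin 3) (Fin 3) ℝ) (x : Fin N → Fin 3 → ℝ) :
    blockLin Φ x = blockApp Φ x := rfl

lemma blockLin_braN {Φ : Fin N → Matrix (Fin 3) (Fin 3) ℝ} (hΦ : ∀ i, so3 (Φ i))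
    (x y : Fin N → Fin 3 → ℝ) :
    blockLin Φ (braN x y) = braN (blockLin Φ x) (blockLin Φ y) :=
  funext fun i => so3_mulVec_cross (hΦ i) (x i) (y i)

lemma blockLin_transpose {Φ : Fin N → Matrix (Fin 3) (Fin 3) ℝ} (hΦ : ∀ i, so3 (Φ i))
    (x : Fin N → Fin 3 → ℝ) : blockLin Φ (blockLin (fun i => (Φ i)ᵀ) x) = x := by
  ext1 i
  change Φ i *ᵥ ((Φ i)ᵀ *ᵥ x i) = x i
  rw [Matrix.mulVec_mulVec, (hΦ i).1, Matrix.one_mulVec]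

lemma isCxN_conj (hJ : isCxN J) {Φ : Fin N → Matrix (Fin 3) (Fin 3) ℝ}
    (hΦ : ∀ i, so3 (Φ i)) : isCxN (blockLin (fun i => (Φ i)ᵀ) ∘ₗ J ∘ₗ blockLin Φ) := by
  have hΦ' : ∀ i, so3 (Φ i)ᵀ := fun i => so3_transpose (hΦ i)
  have hinv : ∀ x, blockLin (fun i => (Φ i)ᵀ) (blockLin Φ x) = x := fun x => by
    simpa using blockLin_transpose hΦ' x
  refine ⟨fun X => ?_, fun X Y => ?_⟩
  · simp only [LinearMap.comp_apply, blockLin_transpose hΦ, hJ.1, map_neg, hinv]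
  · have h := congrArg (blockLin fun i => (Φ i)ᵀ) (hJ.2 (blockLin Φ X) (blockLin Φ Y))
    simp only [map_sub, map_zero, blockLin_braN hΦ', hinv] at h
    simpa only [LinearMap.comp_apply, blockLin_braN hΦ, blockLin_transpose hΦ] using h

/-- A complex structure acting as the standard rotation on the first two coordinates of every
factor is in normal form. -/
lemma exists_eq_JMapp (hJ : isCxN J) (h0 : ∀ x i, J x i 0 = x i 1)
    (h1 : ∀ x i, J x i 1 = -x i 0) :
    ∃ M : Matrix (Fin N) (Fin N) ℝ, M * M = -1 ∧ ∀ x, J x = JMapp M x := by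
  let e (j : Fin N) (k : Fin 3) : Fin N → Fin 3 → ℝ := Pi.single j (Pi.single k 1)
  have hX : ∀ j, J (e j 0) = -e j 1 := fun j => by
    set m := J (e j 2) j 2 with hm
    have hJXW : braN (J (e j 0)) (J (e j 2)) = -(m • e j 0) := by
      ext i k
      by_cases hij : i = j
      · subst hij
        fin_cases k <;> simp [braN, cross, h0, h1, e, hm]
      · fin_cases k <;> simp [braN, cross, h0, h1, e, hij]
    have hXW : braN (e j 0) (e j 2) = -e j 1 := by
      ext i k
      by_cases hij : i = j
      · subst hij
        fin_cases k <;> simp [braN, cross, e]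
      · fin_cases k <;> simp [braN, cross, e, hij]
    have hJX : braN (J (e j 0)) (e j 2) = -e j 0 := by
      ext i k
      by_cases hij : i = j
      · subst hij
        fin_cases k <;> simp [braN, cross, h0, h1, e]
      · fin_cases k <;> simp [braN, cross, e, hij]
    have hJW : braN (e j 0) (J (e j 2)) = -(m • e j 1) := by
      ext i k
      by_cases hij : i = j
      · subst hij
        fin_cases k <;> simp [braN, cross, h0, h1, e, hm]
      · fin_cases k <;> simp [braN, cross, e, hij]
    have ht := hJ.2 (e j 0) (e j 2)
    rw [hJXW, hXW, hJX, hJW, map_neg, map_neg, map_smul] at ht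
    have ht' := congrArg J ht
    simp only [map_sub, map_neg, map_smul, hJ.1, map_zero] at ht'
    have hsum : (1 + m * m) • (J (e j 0) + e j 1) = 0 := by
      ext i k
      have a := congrFun (congrFun ht i) k
      have b := congrFun (congrFun ht' i) k
      simp only [Pi.add_apply, Pi.sub_apply, Pi.neg_apply, Pi.smul_apply, Pi.zero_apply,
        smul_eq_mul] at a b ⊢
      linear_combination a - m * b
    have hpos : 1 + m * m ≠ 0 := by nlinarith [mul_self_nonneg m]
    exact eq_neg_of_add_eq_zero_left ((smul_eq_zero.1 hsum).resolve_left hpos)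
  have hZ : ∀ j, J (e j 1) = e j 0 := fun j => by
    rw [← neg_neg (e j 1), ← hX, map_neg, hJ.1, neg_neg]
  let M : Matrix (Fin N) (Fin N) ℝ := fun i j => J (e j 2) i 2
  have hM : ∀ x, J x = JMapp M x := fun x => by
    have hx : x = ∑ j, (x j 0 • e j 0 + x j 1 • e j 1 + x j 2 • e j 2) := by
      ext i k
      rw [Finset.sum_apply, Finset.sum_apply, Finset.sum_eq_single i]
      · fin_cases k <;> simp [e]
      · intro j _ hj
        simp [e, Pi.single_eq_of_ne hj.symm]
      · simp
    ext i k
    fin_cases k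
    · simpa [JMapp] using h0 x i
    · simpa [JMapp] using h1 x i
    · conv_lhs => rw [hx]
      simp only [map_sum, map_add, map_smul, hX, hZ, Finset.sum_apply]
      refine Finset.sum_congr rfl fun j _ => ?_
      by_cases hij : i = j
      · subst hij
        simp [e, M, mul_comm]
      · simp [e, M, hij, mul_comm]
  refine ⟨M, ?_, hM⟩
  ext i j
  rw [Matrix.mul_apply]
  have h := congrFun (congrFun (hJ.1 (e j 2)) i) 2
  rw [hM] at h
  by_cases hij : i = j
  · subst hij
    simpa [JMapp, M, e] using h
  · simpa [JMapp, M, e, hij, Matrix.one_apply_ne hij] using h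

/-- The rotation with columns `u`, `v` and `u × v`. -/
def frame (u v : Fin 3 → ℝ) : Matrix (Fin 3) (Fin 3) ℝ := (Matrix.of ![u, v, u ⨯₃ v])ᵀ

lemma so3_frame {u v : Fin 3 → ℝ} (hu : u ⬝ᵥ u = 1) (hv : v ⬝ᵥ v = 1) (huv : u ⬝ᵥ v = 0) :
    so3 (frame u v) := by
  have h : (frame u v)ᵀ * frame u v = 1 := by
    ext i j
    change ![u, v, u ⨯₃ v] i ⬝ᵥ ![u, v, u ⨯₃ v] j = _
    fin_cases i <;> fin_cases j <;>
      simp [hu, hv, huv, dotProduct_comm v u, cross_dot_cross, dotProduct_comm (u ⨯₃ v)]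
  refine ⟨mul_eq_one_comm.1 h, ?_⟩
  rw [frame, Matrix.det_transpose]
  change Matrix.det ![u, v, u ⨯₃ v] = 1
  rw [← triple_product_eq_det, triple_product_permutation, triple_product_permutation,
    cross_dot_cross]
  simp [hu, hv, huv]

/-- Every complex structure is conjugate to a normal form. -/
theorem exists_conj_JMapp (hJ : isCxN J) :
    ∃ (Φ : Fin N → Matrix (Fin 3) (Fin 3) ℝ) (M : Matrix (Fin N) (Fin N) ℝ),
      (∀ i, so3 (Φ i)) ∧ M * M = -1 ∧ ∀ x, J (blockApp Φ x) = blockApp Φ (JMapp M x) := by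
  choose u v hu hv huv hrot using exists_rotated_plane hJ
  let Φ i := frame (u i) (v i)
  have hΦ : ∀ i, so3 (Φ i) := fun i => so3_frame (hu i) (hv i) (huv i)
  have hinv : ∀ x i, (Φ i)ᵀ *ᵥ (blockLin Φ x i) = x i := fun x i => by
    change (Φ i)ᵀ *ᵥ (Φ i *ᵥ x i) = x i
    rw [Matrix.mulVec_mulVec, mul_eq_one_comm.1 (hΦ i).1, Matrix.one_mulVec]
  obtain ⟨M, hM, h⟩ := exists_eq_JMapp (isCxN_conj hJ hΦ)
    (fun x i => ((hrot i (blockLin Φ x)).1.trans (congrFun (hinv x i) 1)))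
    (fun x i => ((hrot i (blockLin Φ x)).2.trans (congrArg Neg.neg (congrFun (hinv x i) 0))))
  refine ⟨Φ, M, hΦ, hM, fun x => ?_⟩
  rw [← h x, ← blockLin_apply, ← blockLin_apply]
  exact (blockLin_transpose hΦ _).symm

lemma sum_mul_mulVec_single (f : Fin N → ℝ) (Φ : Fin N → Matrix (Fin 3) (Fin 3) ℝ) (j : Fin N)
    (y : Fin 3 → ℝ) :
    ∑ l, f l * (Φ l *ᵥ (Pi.single j y : Fin N → Fin 3 → ℝ) l) 2 = f j * (Φ j *ᵥ y) 2 := by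
  rw [Finset.sum_eq_single j]
  · simp
  · intro l _ hl
    simp [Pi.single_eq_of_ne hl]
  · simp

lemma sum_mul_single (f : Fin N → ℝ) (j : Fin N) (y : Fin 3 → ℝ) :
    ∑ l, f l * (Pi.single j y : Fin N → Fin 3 → ℝ) l 2 = f j * y 2 := by
  simpa using sum_mul_mulVec_single f (fun _ => 1) j y

/-- Two normal forms are conjugate under `τ_σ(SO(3)^N)` iff `σ` carries one matrix to the other. -/
theorem conj_perm_iff (M M' : Matrix (Fin N) (Fin N) ℝ) (σ : Equiv.Perm (Fin N)) :
    (∃ Φ : Fin N → Matrix (Fin 3) (Fin 3) ℝ, (∀ i, so3 (Φ i)) ∧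
        ∀ x, tauPerm σ (blockApp Φ (JMapp M x)) = JMapp M' (tauPerm σ (blockApp Φ x))) ↔
      ∀ i j, M' i j = M (σ⁻¹ i) (σ⁻¹ j) := by
  constructor
  · rintro ⟨Φ, hΦ, h⟩
    have hk : ∀ x i, Φ i *ᵥ JMapp M x i =
        ![(Φ i *ᵥ x i) 1, -(Φ i *ᵥ x i) 0, ∑ j, M' (σ i) (σ j) * (Φ j *ᵥ x j) 2] :=
      fun x i => by
        have hi := congrFun (h x) (σ i)
        have hσ : ∀ j, σ⁻¹ (σ j) = j := fun j => by simp
        have hsum := Equiv.sum_comp σ fun j => M' (σ i) j * (Φ (σ⁻¹ j) *ᵥ x (σ⁻¹ j)) 2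
        simp only [hσ] at hsum
        have hr : JMapp M' (tauPerm σ (blockApp Φ x)) (σ i) =
            ![(Φ (σ⁻¹ (σ i)) *ᵥ x (σ⁻¹ (σ i))) 1, -(Φ (σ⁻¹ (σ i)) *ᵥ x (σ⁻¹ (σ i))) 0,
              ∑ j, M' (σ i) j * (Φ (σ⁻¹ j) *ᵥ x (σ⁻¹ j)) 2] := rfl
        rw [hσ] at hr
        rw [hsum, ← hr]
        simpa only [tauPerm, blockApp, hσ] using hi
    have hentries : ∀ i, Φ i 0 2 = 0 ∧ Φ i 1 2 = 0 ∧ Φ i 2 2 = 1 := fun i => by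
      have hx := hk (Pi.single i (Pi.single 0 1)) i
      have hz := hk (Pi.single i (Pi.single 2 1)) i
      rw [sum_mul_mulVec_single] at hx hz
      have hdet := (hΦ i).2
      have horth := congrFun (congrFun (hΦ i).1 0) 0
      rw [Matrix.det_fin_three] at hdet
      simp [JMapp, sum_mul_single, Matrix.mulVec, dotProduct, Matrix.mul_apply,
        Fin.sum_univ_three, funext_iff, Fin.forall_fin_succ] at hx hz horth
      have hpos : 1 + M i i ^ 2 ≠ 0 := by positivity
      have h02 : Φ i 0 2 = 0 := by
        have : (1 + M i i ^ 2) * Φ i 0 2 = 0 := by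
          linear_combination M i i * hz.1 + hz.2.1
        exact (mul_eq_zero.1 this).resolve_left hpos
      have h12 : Φ i 1 2 = 0 := by rw [← hz.1, h02, zero_mul]
      refine ⟨h02, h12, ?_⟩
      rw [h02, h12] at hdet
      rw [h02] at horth
      linear_combination hdet - Φ i 2 2 * horth - Φ i 2 2 * Φ i 0 0 * hx.2.1
        - Φ i 2 2 * Φ i 0 1 * hx.1
    have hM : ∀ i j, M' (σ i) (σ j) = M i j := fun i j => by
      have hz := congrFun (hk (Pi.single j (Pi.single 2 1)) i) 2
      rw [sum_mul_mulVec_single] at hz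
      obtain rfl | hij := eq_or_ne i j
      · simpa [JMapp, sum_mul_single, Matrix.mulVec, dotProduct, Fin.sum_univ_three,
          hentries] using hz.symm
      · simpa [JMapp, sum_mul_single, Matrix.mulVec, dotProduct, Fin.sum_univ_three,
          hentries, Pi.single_eq_of_ne hij] using hz.symm
    intro i j
    simpa using hM (σ⁻¹ i) (σ⁻¹ j)
  · intro h
    refine ⟨fun _ => 1, fun _ => ⟨by simp, by simp⟩, fun x => ?_⟩
    ext i k
    have hsum : ∑ j, M (σ⁻¹ i) j * x j 2 = ∑ j, M' i j * x (σ⁻¹ j) 2 := by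
      rw [← Equiv.sum_comp σ⁻¹]
      simp only [h]
    fin_cases k <;> simp [tauPerm, blockApp, JMapp]
    simpa using hsum

end ComplexStructure


/-- For even N: every complex structure on su(2)^N is conjugate under SO(3)^N to J(M) with
M² = −I; J(M) and J(M′) are conjugate under SO(3)^N iff M′ = M, and conjugate under
τ_σ(SO(3)^N) iff M′ᵢⱼ = M_{σ⁻¹(i) σ⁻¹(j)}. -/
theorem stmt15 {N : ℕ} (hN : Even N) :
    (∀ J : (Fin N → Fin 3 → ℝ) →ₗ[ℝ] (Fin N → Fin 3 → ℝ), isCxN J →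
      ∃ (Φ : Fin N → Matrix (Fin 3) (Fin 3) ℝ) (M : Matrix (Fin N) (Fin N) ℝ),
        (∀ i, so3 (Φ i)) ∧ M * M = -1 ∧
        ∀ x, J (blockApp Φ x) = blockApp Φ (JMapp M x)) ∧
    (∀ M M' : Matrix (Fin N) (Fin N) ℝ, M * M = -1 → M' * M' = -1 →
      ((∃ Φ : Fin N → Matrix (Fin 3) (Fin 3) ℝ, (∀ i, so3 (Φ i)) ∧
          ∀ x, blockApp Φ (JMapp M x) = JMapp M' (blockApp Φ x)) ↔ M' = M)) ∧
    (∀ (M M' : Matrix (Fin N) (Fin N) ℝ) (σ : Equiv.Perm (Fin N)),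
      M * M = -1 → M' * M' = -1 →
      ((∃ Φ : Fin N → Matrix (Fin 3) (Fin 3) ℝ, (∀ i, so3 (Φ i)) ∧
          ∀ x, tauPerm σ (blockApp Φ (JMapp M x)) = JMapp M' (tauPerm σ (blockApp Φ x))) ↔
        ∀ i j, M' i j = M (σ⁻¹ i) (σ⁻¹ j))) := by
  refine ⟨fun J hJ => ComplexStructure.exists_conj_JMapp hJ, fun M M' _ _ => ?_,
    fun M M' σ _ _ => ComplexStructure.conj_perm_iff M M' σ⟩
  refine (ComplexStructure.conj_perm_iff M M' 1).trans ?_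
  simp [← Matrix.ext_iff]
end

section
/- A linear map J : u(2) ⊕ u(2) → u(2) ⊕ u(2) has zero torsion if and only if there exist Φ = diag(R₁, b₁, R₂, b₂) with R₁, R₂ ∈ SO(3), b₁, b₂ > 0, and a real 4×4 matrix M = (m_{kl}) such that Φ⁻¹ J Φ = K(M), where K(M) is the linear map whose matrix in the basis (J₁⁽¹⁾,J₂⁽¹⁾,J₃⁽¹⁾,J₄⁽¹⁾,J₁⁽²⁾,J₂⁽²⁾,J₃⁽²⁾,J₄⁽²⁾) has rows (0,1,0,0,0,0,0,0), (−1,0,0,0,0,0,0,0), (0,0,m₁₁,m₁₂,0,0,m₁₃,m₁₄), (0,0,m₂₁,m₂₂,0,0,m₂₃,m₂₄), (0,0,0,0,0,1,0,0), (0,0,0,0,−1,0,0,0), (0,0,m₃₁,m₃₂,0,0,m₃₃,m₃₄), (0,0,m₄₁,m₄₂,0,0,m₄₃,m₄₄). -/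
/-- The Lie bracket of u(2) ⊕ u(2) in the basis
(J₁⁽¹⁾,J₂⁽¹⁾,J₃⁽¹⁾,J₄⁽¹⁾,J₁⁽²⁾,J₂⁽²⁾,J₃⁽²⁾,J₄⁽²⁾). -/
def bra8 (x y : Fin 8 → ℝ) : Fin 8 → ℝ :=
  ![x 1 * y 2 - x 2 * y 1, x 2 * y 0 - x 0 * y 2, x 0 * y 1 - x 1 * y 0, 0,
    x 5 * y 6 - x 6 * y 5, x 6 * y 4 - x 4 * y 6, x 4 * y 5 - x 5 * y 4, 0]

/-- `J` (as an 8×8 matrix) has zero torsion on u(2) ⊕ u(2). -/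
def torsion8 (J : Matrix (Fin 8) (Fin 8) ℝ) : Prop :=
  ∀ X Y : Fin 8 → ℝ,
    bra8 (J.mulVec X) (J.mulVec Y) - bra8 X Y
      - J.mulVec (bra8 (J.mulVec X) Y) - J.mulVec (bra8 X (J.mulVec Y)) = 0

/-- The normal form K(M), M a real 4×4 matrix (mₖₗ = M (k-1) (l-1)). -/
def KM (M : Matrix (Fin 4) (Fin 4) ℝ) : Matrix (Fin 8) (Fin 8) ℝ :=
  !![0, 1, 0, 0, 0, 0, 0, 0;
     -1, 0, 0, 0, 0, 0, 0, 0;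
     0, 0, M 0 0, M 0 1, 0, 0, M 0 2, M 0 3;
     0, 0, M 1 0, M 1 1, 0, 0, M 1 2, M 1 3;
     0, 0, 0, 0, 0, 1, 0, 0;
     0, 0, 0, 0, -1, 0, 0, 0;
     0, 0, M 2 0, M 2 1, 0, 0, M 2 2, M 2 3;
     0, 0, M 3 0, M 3 1, 0, 0, M 3 2, M 3 3]

/-- The block-diagonal matrix diag(R₁, b₁, R₂, b₂). -/
def diag8 (R₁ : Matrix (Fin 3) (Fin 3) ℝ) (b₁ : ℝ) (R₂ : Matrix (Fin 3) (Fin 3) ℝ)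
    (b₂ : ℝ) : Matrix (Fin 8) (Fin 8) ℝ :=
  !![R₁ 0 0, R₁ 0 1, R₁ 0 2, 0, 0, 0, 0, 0;
     R₁ 1 0, R₁ 1 1, R₁ 1 2, 0, 0, 0, 0, 0;
     R₁ 2 0, R₁ 2 1, R₁ 2 2, 0, 0, 0, 0, 0;
     0, 0, 0, b₁, 0, 0, 0, 0;
     0, 0, 0, 0, R₂ 0 0, R₂ 0 1, R₂ 0 2, 0;
     0, 0, 0, 0, R₂ 1 0, R₂ 1 1, R₂ 1 2, 0;
     0, 0, 0, 0, R₂ 2 0, R₂ 2 1, R₂ 2 2, 0;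
     0, 0, 0, 0, 0, 0, 0, b₂]


open Matrix Module

/-- An ideal of the complex cross product algebra is trivial. -/
lemma cross_ideal_eq_bot_or_top (I : Submodule ℂ (Fin 3 → ℂ))
    (hI : ∀ x ∈ I, ∀ y, x ⨯₃ y ∈ I) : I = ⊥ ∨ I = ⊤ := by
  by_cases h : I = ⊥
  · exact Or.inl h
  right
  obtain ⟨x, hx, hx0⟩ := Submodule.exists_mem_ne_zero_of_ne_bot h
  obtain ⟨i, hi⟩ := Function.ne_iff.mp hx0
  rw [eq_top_iff]
  rintro a -
  have h1 := hI _ (hI x hx a) (Pi.single i 1)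
  have h2 : (x ⨯₃ a) ⨯₃ (Pi.single i 1) = x i • a - a i • x := by
    ext j
    fin_cases i <;> fin_cases j <;> simp [cross_apply] <;> ring
  rw [h2] at h1
  have h3 : x i • a ∈ I := by
    simpa using I.add_mem h1 (I.smul_mem (a i) hx)
  have h4 := I.smul_mem (x i)⁻¹ h3
  rwa [smul_smul, inv_mul_cancel₀ hi, one_smul] at h4

/-- A nonzero endomorphism of the complex cross product algebra is special orthogonal. -/
lemma cross_hom_eq_zero_or_orthogonal (φ : (Fin 3 → ℂ) →ₗ[ℂ] (Fin 3 → ℂ))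
    (hφ : ∀ x y, φ (x ⨯₃ y) = φ x ⨯₃ φ y) :
    φ = 0 ∨ (LinearMap.toMatrix' φ * (LinearMap.toMatrix' φ)ᵀ = 1 ∧
      (LinearMap.toMatrix' φ).det = 1) := by
  rcases cross_ideal_eq_bot_or_top (LinearMap.ker φ)
    (fun x hx y => by
      rw [LinearMap.mem_ker] at hx ⊢
      rw [hφ, hx]; simp) with h | h
  · right
    set A := LinearMap.toMatrix' φ with hA
    have hAφ : ∀ x, φ x = A *ᵥ x := fun x => (LinearMap.toMatrix'_mulVec φ x).symm
    have hdet : A.det ≠ 0 := by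
      intro h0
      obtain ⟨v, hv, hv0⟩ := Matrix.exists_mulVec_eq_zero_iff.mpr h0
      apply hv
      have : v ∈ LinearMap.ker φ := by rw [LinearMap.mem_ker, hAφ, hv0]
      simpa [h] using this
    have hadj : A.adjugate = Aᵀ := by
      have e01 := hφ (Pi.single 0 1) (Pi.single 1 1)
      have e12 := hφ (Pi.single 1 1) (Pi.single 2 1)
      have e20 := hφ (Pi.single 2 1) (Pi.single 0 1)
      rw [hAφ, hAφ, hAφ] at e01 e12 e20
      simp [cross_apply, funext_iff, Fin.forall_fin_succ, Matrix.mulVec, dotProduct,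
        Fin.sum_univ_succ] at e01 e12 e20
      ext i j
      rw [Matrix.adjugate_fin_three]
      fin_cases i <;> fin_cases j <;> simp <;> grind
    have hmul : A * Aᵀ = A.det • (1 : Matrix (Fin 3) (Fin 3) ℂ) := by
      rw [← hadj, Matrix.mul_adjugate]
    have hd := congrArg Matrix.det hmul
    rw [Matrix.det_mul, Matrix.det_transpose, Matrix.det_smul, Matrix.det_one] at hd
    have h1 : A.det = 1 := by
      have : A.det ^ 2 * (A.det - 1) = 0 := by
        simp at hd; linear_combination -hd
      rcases mul_eq_zero.mp this with h' | h'
      · exact absurd (pow_eq_zero_iff (by norm_num) |>.mp h') hdet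
      · linear_combination h'
    exact ⟨by rw [hmul, h1, one_smul], h1⟩
  · left
    exact LinearMap.ker_eq_top.mp h

/-- Two nonzero endomorphisms of the complex cross product algebra agree on a nonzero vector, so
their difference is not surjective. -/
lemma cross_hom_sub_surjective (φ ψ : (Fin 3 → ℂ) →ₗ[ℂ] (Fin 3 → ℂ))
    (hφ : ∀ x y, φ (x ⨯₃ y) = φ x ⨯₃ φ y) (hψ : ∀ x y, ψ (x ⨯₃ y) = ψ x ⨯₃ ψ y)
    (hs : Function.Surjective (φ - ψ)) : φ = 0 ∨ ψ = 0 := by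
  rcases cross_hom_eq_zero_or_orthogonal φ hφ with h | ⟨hA, hA1⟩
  · exact Or.inl h
  rcases cross_hom_eq_zero_or_orthogonal ψ hψ with h | ⟨hC, hC1⟩
  · exact Or.inr h
  exfalso
  set A := LinearMap.toMatrix' φ with hAdef
  set C := LinearMap.toMatrix' ψ with hCdef
  have hA' : Aᵀ * A = 1 := mul_eq_one_comm.mp hA
  have h1 : Aᵀ * (A - C) * Cᵀ = -(A - C)ᵀ := by
    rw [mul_sub, sub_mul, hA', Matrix.mul_assoc, hC, Matrix.transpose_sub]
    simp
  have h2 := congrArg Matrix.det h1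
  rw [Matrix.det_neg, Matrix.det_mul, Matrix.det_mul, Matrix.det_transpose, Matrix.det_transpose,
    Matrix.det_transpose, hA1, hC1] at h2
  have h3 : (A - C).det = 0 := by
    simp at h2
    linear_combination h2 / 2
  obtain ⟨v, hv, hv0⟩ := Matrix.exists_mulVec_eq_zero_iff.mpr h3
  apply hv
  apply LinearMap.injective_iff_surjective.mpr hs
  rw [map_zero, ← hv0, ← LinearMap.toMatrix'_mulVec, map_sub]

section Homs

variable {V : Type*} [AddCommGroup V] [Module ℂ V]

/-- The image of an ideal under a surjective map to the cross product algebra is trivial. -/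
lemma map_ideal_eq_bot_or_top (B : V → V → V) (p : V →ₗ[ℂ] (Fin 3 → ℂ))
    (hp : ∀ X Y, p (B X Y) = p X ⨯₃ p Y) (W I : Submodule ℂ V)
    (hI : ∀ X ∈ I, ∀ Y ∈ W, B X Y ∈ I) (hW : W.map p = ⊤) : I.map p = ⊥ ∨ I.map p = ⊤ := by
  apply cross_ideal_eq_bot_or_top
  rintro _ ⟨X, hX, rfl⟩ y
  obtain ⟨Y, hY, rfl⟩ : y ∈ W.map p := hW ▸ Submodule.mem_top
  exact ⟨B X Y, hI X hX Y hY, hp X Y⟩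

lemma exists_section_of_map_eq_top (p : V →ₗ[ℂ] (Fin 3 → ℂ)) (W : Submodule ℂ V)
    (hW : W.map p = ⊤) : ∃ s : (Fin 3 → ℂ) →ₗ[ℂ] V, ∀ x, s x ∈ W ∧ p (s x) = x := by
  obtain ⟨s, hs⟩ := LinearMap.exists_rightInverse_of_surjective (p.domRestrict W)
    (by rw [LinearMap.range_domRestrict, hW])
  exact ⟨W.subtype ∘ₗ s, fun x => ⟨(s x).2, LinearMap.congr_fun hs x⟩⟩

/-- A homomorphism to the cross product algebra factors through any surjective one whose kernel it
annihilates. -/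
lemma exists_factor (B : V → V → V) (r p : V →ₗ[ℂ] (Fin 3 → ℂ))
    (hr : ∀ X Y, r (B X Y) = r X ⨯₃ r Y) (hp : ∀ X Y, p (B X Y) = p X ⨯₃ p Y)
    (W : Submodule ℂ V) (hB : ∀ X ∈ W, ∀ Y ∈ W, B X Y ∈ W) (hW : W.map r = ⊤)
    (hk : ∀ X ∈ W, r X = 0 → p X = 0) :
    ∃ φ : (Fin 3 → ℂ) →ₗ[ℂ] (Fin 3 → ℂ), (∀ x y, φ (x ⨯₃ y) = φ x ⨯₃ φ y) ∧
      ∀ X ∈ W, p X = φ (r X) := by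
  obtain ⟨s, hs⟩ := exists_section_of_map_eq_top r W hW
  have hfac : ∀ X ∈ W, p X = p (s (r X)) := by
    intro X hX
    have := hk (X - s (r X)) (W.sub_mem hX (hs _).1) (by rw [map_sub, (hs _).2, sub_self])
    rwa [map_sub, sub_eq_zero] at this
  refine ⟨p ∘ₗ s, fun x y => ?_, hfac⟩
  have := hfac (B (s x) (s y)) (hB _ (hs x).1 _ (hs y).1)
  rw [hr, hp, (hs x).2, (hs y).2] at this
  exact this.symm

/-- A surjective homomorphism to the cross product algebra stays surjective on the kernel of a
nonsurjective one. -/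
lemma map_inf_ker_eq_top (B : V → V → V) (p q : V →ₗ[ℂ] (Fin 3 → ℂ))
    (hp : ∀ X Y, p (B X Y) = p X ⨯₃ p Y) (hq : ∀ X Y, q (B X Y) = q X ⨯₃ q Y)
    (W : Submodule ℂ V) (hB : ∀ X ∈ W, ∀ Y ∈ W, B X Y ∈ W) (hW : W.map p = ⊤)
    (hqs : ¬ Function.Surjective q) : (W ⊓ LinearMap.ker q).map p = ⊤ := by
  refine (map_ideal_eq_bot_or_top B p hp W _ ?_ hW).resolve_left fun h => hqs ?_
  · rintro X ⟨hX, hX'⟩ Y hY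
    refine ⟨hB X hX Y hY, ?_⟩
    simp only [SetLike.mem_coe, LinearMap.mem_ker] at hX' ⊢
    rw [hq, hX']; simp
  · obtain ⟨s, hs⟩ := exists_section_of_map_eq_top p W hW
    have hinj : Function.Injective (q ∘ₗ s) := by
      rw [injective_iff_map_eq_zero]
      intro y hy
      have : p (s y) ∈ (W ⊓ LinearMap.ker q).map p := ⟨s y, ⟨(hs y).1, hy⟩, rfl⟩
      rw [h, Submodule.mem_bot, (hs y).2] at this
      exact this
    exact Function.Surjective.of_comp (g := s) (LinearMap.injective_iff_surjective.mp hinj)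

lemma not_surjective_of_conj [FiniteDimensional ℂ V] (hV : finrank ℂ V = 8) (B : V → V → V)
    (σ : V → V) (p₁ q₁ p₂ q₂ : V →ₗ[ℂ] (Fin 3 → ℂ))
    (hp₁ : ∀ X Y, p₁ (B X Y) = p₁ X ⨯₃ p₁ Y) (hq₁ : ∀ X Y, q₁ (B X Y) = q₁ X ⨯₃ q₁ Y)
    (hp₂ : ∀ X Y, p₂ (B X Y) = p₂ X ⨯₃ p₂ Y) (hq₂ : ∀ X Y, q₂ (B X Y) = q₂ X ⨯₃ q₂ Y)
    (hσp₁ : ∀ X, p₁ (σ X) = star (q₁ X)) (hσq₁ : ∀ X, q₁ (σ X) = star (p₁ X))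
    (hσp₂ : ∀ X, p₂ (σ X) = star (q₂ X)) (hσq₂ : ∀ X, q₂ (σ X) = star (p₂ X))
    (hs : Function.Surjective ((p₁ - q₁).prod (p₂ - q₂))) : ¬ Function.Surjective p₁ := by
  intro hsp₁
  have hker : ∀ f : V →ₗ[ℂ] (Fin 3 → ℂ) × (Fin 3 → ℂ), Function.Surjective f →
      finrank ℂ (LinearMap.ker f) = 2 := by
    intro f hf
    have := LinearMap.finrank_range_add_finrank_ker f
    rw [LinearMap.range_eq_top.mpr hf, finrank_top, hV] at this
    simp at this
    omega
  have hnot : ∀ (p : V →ₗ[ℂ] (Fin 3 → ℂ)) (I : Submodule ℂ V), finrank ℂ I = 2 →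
      I.map p ≠ ⊤ := by
    intro p I hI h
    have := Submodule.finrank_map_le p I
    rw [h, hI, finrank_top] at this
    simp at this
  have hconj : ∀ p q : V →ₗ[ℂ] (Fin 3 → ℂ), (∀ X, q (σ X) = star (p X)) →
      Function.Surjective p → Function.Surjective q := by
    intro p q h hp y
    obtain ⟨X, hX⟩ := hp (star y)
    exact ⟨σ X, by rw [h, hX, star_star]⟩
  have hsq₁ := hconj p₁ q₁ hσq₁ hsp₁
  have hideal : ∀ p : V →ₗ[ℂ] (Fin 3 → ℂ), (∀ X Y, p (B X Y) = p X ⨯₃ p Y) →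
      ∀ X ∈ LinearMap.ker p, ∀ Y, B X Y ∈ LinearMap.ker p := by
    intro p hp X hX Y
    rw [LinearMap.mem_ker] at hX ⊢
    rw [hp, hX]; simp
  have htop : ∀ p : V →ₗ[ℂ] (Fin 3 → ℂ), Function.Surjective p →
      (⊤ : Submodule ℂ V).map p = ⊤ := by
    intro p h
    rw [Submodule.map_top, LinearMap.range_eq_top.mpr h]
  rcases map_ideal_eq_bot_or_top B p₁ hp₁ ⊤ (LinearMap.ker q₁)
    (fun X hX Y _ => hideal q₁ hq₁ X hX Y) (htop p₁ hsp₁) with h | hp₁q₁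
  · obtain ⟨φ, hφ, hφp⟩ := exists_factor B q₁ p₁ hq₁ hp₁ ⊤ (fun _ _ _ _ => trivial)
      (htop q₁ hsq₁) (fun X _ hX => by
        have : p₁ X ∈ (LinearMap.ker q₁).map p₁ := ⟨X, hX, rfl⟩
        rwa [h] at this)
    have hsub : Function.Surjective
        (φ - (LinearMap.id : (Fin 3 → ℂ) →ₗ[ℂ] (Fin 3 → ℂ))) := by
      intro y
      obtain ⟨X, hX⟩ := hs (y, 0)
      refine ⟨q₁ X, ?_⟩
      have := congrArg Prod.fst hX
      simpa [hφp X trivial] using this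
    rcases cross_hom_sub_surjective φ LinearMap.id hφ (fun _ _ => rfl) hsub with h0 | h0
    · obtain ⟨X, hX⟩ := hsp₁ 1
      rw [hφp X trivial, h0] at hX
      exact zero_ne_one hX
    · exact zero_ne_one (LinearMap.congr_fun h0 1).symm
  have hq₁p₁ : ∀ y, ∃ X, p₁ X = 0 ∧ q₁ X = y := by
    intro y
    obtain ⟨X, hX, hX'⟩ : star y ∈ (LinearMap.ker q₁).map p₁ := hp₁q₁ ▸ Submodule.mem_top
    refine ⟨σ X, ?_, ?_⟩
    · rw [hσp₁, LinearMap.mem_ker.mp hX, star_zero]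
    · rw [hσq₁, hX', star_star]
  by_cases hsp₂ : Function.Surjective p₂
  · have hsq₂ := hconj p₂ q₂ hσq₂ hsp₂
    have hK : finrank ℂ (LinearMap.ker (p₁.prod q₁)) = 2 := by
      apply hker
      rintro ⟨x, y⟩
      obtain ⟨X, hX, hX'⟩ : x ∈ (LinearMap.ker q₁).map p₁ := hp₁q₁ ▸ Submodule.mem_top
      obtain ⟨Y, hY, hY'⟩ := hq₁p₁ y
      rw [SetLike.mem_coe, LinearMap.mem_ker] at hX
      exact ⟨X + Y, by simp [hX, hX', hY, hY']⟩
    have hKp : ∀ p : V →ₗ[ℂ] (Fin 3 → ℂ), (∀ X Y, p (B X Y) = p X ⨯₃ p Y) →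
        Function.Surjective p → ∀ X, p₁ X = 0 → q₁ X = 0 → p X = 0 := by
      intro p hp hps X hX hX'
      have h := (map_ideal_eq_bot_or_top B p hp ⊤ (LinearMap.ker (p₁.prod q₁)) (by
        intro X hX Y _
        rw [LinearMap.ker_prod] at hX ⊢
        exact ⟨hideal p₁ hp₁ X hX.1 Y, hideal q₁ hq₁ X hX.2 Y⟩) (htop p hps)).resolve_right
        (hnot p _ hK)
      have : p X ∈ (LinearMap.ker (p₁.prod q₁)).map p :=
        ⟨X, by simp [hX, hX'], rfl⟩
      rwa [h] at this
    set W := LinearMap.ker (p₁ - q₁) with hWdef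
    have hWmem : ∀ X, X ∈ W ↔ p₁ X = q₁ X := fun X => by
      rw [hWdef, LinearMap.mem_ker, LinearMap.sub_apply, sub_eq_zero]
    have hWB : ∀ X ∈ W, ∀ Y ∈ W, B X Y ∈ W := by
      intro X hX Y hY
      rw [hWmem] at hX hY ⊢
      rw [hp₁, hq₁, hX, hY]
    have hWp : W.map p₁ = ⊤ := by
      rw [eq_top_iff]
      rintro y -
      obtain ⟨X, hX, hX'⟩ : y ∈ (LinearMap.ker q₁).map p₁ := hp₁q₁ ▸ Submodule.mem_top
      obtain ⟨Y, hY, hY'⟩ := hq₁p₁ y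
      rw [SetLike.mem_coe, LinearMap.mem_ker] at hX
      exact ⟨X + Y, (hWmem _).mpr (by simp [hX, hX', hY, hY']), by simp [hX', hY]⟩
    obtain ⟨φ, hφ, hφp⟩ := exists_factor B p₁ p₂ hp₁ hp₂ W hWB hWp
      (fun X hX h0 => hKp p₂ hp₂ hsp₂ X h0 (((hWmem X).mp hX) ▸ h0))
    obtain ⟨ψ, hψ, hψq⟩ := exists_factor B p₁ q₂ hp₁ hq₂ W hWB hWp
      (fun X hX h0 => hKp q₂ hq₂ hsq₂ X h0 (((hWmem X).mp hX) ▸ h0))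
    have hWs : ∀ y, ∃ X ∈ W, p₂ X - q₂ X = y := by
      intro y
      obtain ⟨X, hX⟩ := hs (0, y)
      exact ⟨X, congrArg Prod.fst hX, congrArg Prod.snd hX⟩
    have hWσ : ∀ X ∈ W, σ X ∈ W := by
      intro X hX
      rw [hWmem] at hX ⊢
      rw [hσp₁, hσq₁, hX]
    have hsub : Function.Surjective (φ - ψ) := by
      intro y
      obtain ⟨X, hX, hXy⟩ := hWs y
      exact ⟨p₁ X, by rw [LinearMap.sub_apply, ← hφp X hX, ← hψq X hX, hXy]⟩
    have hzero : ∀ X ∈ W, p₂ X = 0 ∧ q₂ X = 0 := by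
      intro X hX
      rcases cross_hom_sub_surjective φ ψ hφ hψ hsub with h0 | h0
      · have h1 := hφp _ (hWσ X hX)
        rw [hσp₂, h0, LinearMap.zero_apply, star_eq_zero] at h1
        exact ⟨by rw [hφp X hX, h0, LinearMap.zero_apply], h1⟩
      · have h1 := hψq _ (hWσ X hX)
        rw [hσq₂, h0, LinearMap.zero_apply, star_eq_zero] at h1
        exact ⟨h1, by rw [hψq X hX, h0, LinearMap.zero_apply]⟩
    obtain ⟨X, hX, hX1⟩ := hWs 1
    rw [(hzero X hX).1, (hzero X hX).2, sub_zero] at hX1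
    exact zero_ne_one hX1
  · have hsq₂ : ¬ Function.Surjective q₂ := fun h => hsp₂ (hconj q₂ p₂ hσp₂ h)
    have hker₁ := map_inf_ker_eq_top B p₁ p₂ hp₁ hp₂ (LinearMap.ker q₁)
      (fun X hX Y _ => hideal q₁ hq₁ X hX Y) hp₁q₁ hsp₂
    have hker₂ := map_inf_ker_eq_top B p₁ q₂ hp₁ hq₂ (LinearMap.ker q₁ ⊓ LinearMap.ker p₂)
      (fun X hX Y _ => ⟨hideal q₁ hq₁ X hX.1 Y, hideal p₂ hp₂ X hX.2 Y⟩) hker₁ hsq₂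
    refine hnot p₁ _ (hker _ hs) ?_
    rw [eq_top_iff]
    rintro y -
    obtain ⟨X, ⟨⟨hX1, hX2⟩, hX3⟩, hX⟩ :
      y ∈ (LinearMap.ker q₁ ⊓ LinearMap.ker p₂ ⊓ LinearMap.ker q₂).map p₁ :=
        hker₂ ▸ Submodule.mem_top
    obtain ⟨Y, ⟨⟨hY1, hY2⟩, hY3⟩, hY⟩ :
      star y ∈ (LinearMap.ker q₁ ⊓ LinearMap.ker p₂ ⊓ LinearMap.ker q₂).map p₁ :=
        hker₂ ▸ Submodule.mem_top
    simp only [SetLike.mem_coe, LinearMap.mem_ker] at hX1 hX2 hX3 hY1 hY2 hY3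
    refine ⟨X + σ Y, ?_, ?_⟩
    · simp [hσp₁, hσq₁, hσp₂, hσq₂, hX1, hX2, hX3, hX, hY1, hY2, hY3, hY]
    · simp [hσp₁, hX, hY1]

end Homs

lemma diag8_mulVec (R S : Matrix (Fin 3) (Fin 3) ℝ) (b c : ℝ) (X : Fin 8 → ℝ) :
    diag8 R b S c *ᵥ X =
      ![R 0 0 * X 0 + R 0 1 * X 1 + R 0 2 * X 2, R 1 0 * X 0 + R 1 1 * X 1 + R 1 2 * X 2,
        R 2 0 * X 0 + R 2 1 * X 1 + R 2 2 * X 2, b * X 3,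
        S 0 0 * X 4 + S 0 1 * X 5 + S 0 2 * X 6, S 1 0 * X 4 + S 1 1 * X 5 + S 1 2 * X 6,
        S 2 0 * X 4 + S 2 1 * X 5 + S 2 2 * X 6, c * X 7] := by
  ext i
  fin_cases i <;> simp [diag8, Matrix.mulVec, dotProduct, Fin.sum_univ_eight]

lemma diag8_mul (R R' S S' : Matrix (Fin 3) (Fin 3) ℝ) (b b' c c' : ℝ) :
    diag8 R b S c * diag8 R' b' S' c' = diag8 (R * R') (b * b') (S * S') (c * c') := by
  refine Matrix.ext_of_mulVec_single fun j => ?_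
  rw [← Matrix.mulVec_mulVec, diag8_mulVec, diag8_mulVec, diag8_mulVec]
  simp only [Matrix.mul_apply, Fin.sum_univ_three]
  generalize (Pi.single j 1 : Fin 8 → ℝ) = X
  ext i
  fin_cases i <;> simp <;> ring

lemma diag8_one : diag8 1 1 1 1 = 1 := by
  ext i j
  fin_cases i <;> fin_cases j <;> simp [diag8]

lemma diag8_mul_inverse {R S : Matrix (Fin 3) (Fin 3) ℝ} (hR : so3 R) (hS : so3 S) {b c : ℝ}
    (hb : b ≠ 0) (hc : c ≠ 0) : diag8 R b S c * diag8 Rᵀ b⁻¹ Sᵀ c⁻¹ = 1 := by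
  rw [diag8_mul, hR.1, hS.1, mul_inv_cancel₀ hb, mul_inv_cancel₀ hc, diag8_one]

lemma so3_transpose {R : Matrix (Fin 3) (Fin 3) ℝ} (hR : so3 R) : so3 Rᵀ :=
  ⟨by rw [Matrix.transpose_transpose, mul_eq_one_comm.mp hR.1], by
    rw [Matrix.det_transpose, hR.2]⟩

lemma so3_adjugate {R : Matrix (Fin 3) (Fin 3) ℝ} (hR : so3 R) : R.adjugate = Rᵀ := by
  have h : R * R.adjugate = R * Rᵀ := by rw [Matrix.mul_adjugate, hR.2, one_smul, hR.1]
  have h' := congrArg (Rᵀ * ·) h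
  simpa only [← Matrix.mul_assoc, mul_eq_one_comm.mp hR.1, one_mul] using h'

lemma bra8_diag8 {R S : Matrix (Fin 3) (Fin 3) ℝ} (hR : so3 R) (hS : so3 S) (b c : ℝ)
    (X Y : Fin 8 → ℝ) :
    bra8 (diag8 R b S c *ᵥ X) (diag8 R b S c *ᵥ Y) = diag8 R b S c *ᵥ bra8 X Y := by
  have hR' := so3_adjugate hR
  have hS' := so3_adjugate hS
  rw [Matrix.adjugate_fin_three] at hR' hS'
  simp [← Matrix.ext_iff, Fin.forall_fin_succ] at hR' hS'
  obtain ⟨⟨r1, r2, r3⟩, ⟨r4, r5, r6⟩, r7, r8, r9⟩ := hR'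
  obtain ⟨⟨s1, s2, s3⟩, ⟨s4, s5, s6⟩, s7, s8, s9⟩ := hS'
  simp only [diag8_mulVec]
  ext i
  fin_cases i <;> simp [bra8]
  · rw [← r1, ← r4, ← r7]; ring
  · rw [← r2, ← r5, ← r8]; ring
  · rw [← r3, ← r6, ← r9]; ring
  · rw [← s1, ← s4, ← s7]; ring
  · rw [← s2, ← s5, ← s8]; ring
  · rw [← s3, ← s6, ← s9]; ring

/-- Zero torsion is invariant under Lie algebra automorphisms. -/
lemma torsion8_conj {J Φ Ψ : Matrix (Fin 8) (Fin 8) ℝ} (hJ : torsion8 J) (h : Φ * Ψ = 1)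
    (hΦ : ∀ X Y, bra8 (Φ *ᵥ X) (Φ *ᵥ Y) = Φ *ᵥ bra8 X Y) : torsion8 (Ψ * J * Φ) := by
  have h' : Ψ * Φ = 1 := mul_eq_one_comm.mp h
  have hΨ : ∀ X Y, bra8 (Ψ *ᵥ X) (Ψ *ᵥ Y) = Ψ *ᵥ bra8 X Y := by
    intro X Y
    have := congrArg (Ψ *ᵥ ·) (hΦ (Ψ *ᵥ X) (Ψ *ᵥ Y))
    simp only [Matrix.mulVec_mulVec, h, h', Matrix.one_mulVec] at this
    exact this.symm
  intro X Y
  have hX : X = Ψ *ᵥ (Φ *ᵥ X) := by rw [Matrix.mulVec_mulVec, h', Matrix.one_mulVec]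
  have hY : Y = Ψ *ᵥ (Φ *ᵥ Y) := by rw [Matrix.mulVec_mulVec, h', Matrix.one_mulVec]
  generalize Φ *ᵥ X = X' at hX
  generalize Φ *ᵥ Y = Y' at hY
  have key : ∀ Z, (Ψ * J * Φ) *ᵥ (Ψ *ᵥ Z) = Ψ *ᵥ (J *ᵥ Z) := by
    intro Z
    simp only [Matrix.mulVec_mulVec, Matrix.mul_assoc, h, mul_one]
  rw [hX, hY]
  simp only [key, hΨ]
  rw [← Matrix.mulVec_sub, ← Matrix.mulVec_sub, ← Matrix.mulVec_sub, hJ X' Y',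
    Matrix.mulVec_zero]

lemma KM_mulVec (M : Matrix (Fin 4) (Fin 4) ℝ) (X : Fin 8 → ℝ) :
    KM M *ᵥ X =
      ![X 1, -X 0, M 0 0 * X 2 + M 0 1 * X 3 + M 0 2 * X 6 + M 0 3 * X 7,
        M 1 0 * X 2 + M 1 1 * X 3 + M 1 2 * X 6 + M 1 3 * X 7, X 5, -X 4,
        M 2 0 * X 2 + M 2 1 * X 3 + M 2 2 * X 6 + M 2 3 * X 7,
        M 3 0 * X 2 + M 3 1 * X 3 + M 3 2 * X 6 + M 3 3 * X 7] := by
  ext i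
  fin_cases i <;> simp [KM, Matrix.mulVec, dotProduct, Fin.sum_univ_eight]

lemma torsion8_KM (M : Matrix (Fin 4) (Fin 4) ℝ) : torsion8 (KM M) := by
  intro X Y
  simp only [KM_mulVec]
  ext i
  fin_cases i <;> simp [bra8] <;> ring

/-- If `J` acts on the first two coordinate rows of each `su(2)` factor as in the normal form,
vanishing torsion determines the corresponding columns. -/
lemma exists_eq_KM_of_rows {J : Matrix (Fin 8) (Fin 8) ℝ} (hJ : torsion8 J)
    (h0 : J 0 = Pi.single 1 1) (h1 : J 1 = -Pi.single 0 1)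
    (h4 : J 4 = Pi.single 5 1) (h5 : J 5 = -Pi.single 4 1) : ∃ M, J = KM M := by
  have solve : ∀ m a b : ℝ, a + m * b = 0 → b - m * a = 0 → a = 0 ∧ b = 0 := by
    intro m a b hab hba
    have hb : (1 + m ^ 2) * b = 0 := by linear_combination hba + m * hab
    have hb0 : b = 0 := (mul_eq_zero.mp hb).resolve_left (by positivity)
    exact ⟨by rw [hb0] at hab; linarith, hb0⟩
  have expand : ∀ X Y i, bra8 (J *ᵥ X) (J *ᵥ Y) i - bra8 X Y i
      - (J *ᵥ bra8 (J *ᵥ X) Y) i - (J *ᵥ bra8 X (J *ᵥ Y)) i = 0 :=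
    fun X Y i => congrFun (hJ X Y) i
  have hcol : ∀ i, i ≠ 0 → i ≠ 1 → i ≠ 4 → i ≠ 5 →
      (J i 0 = 0 ∧ J i 1 = 0) ∧ (J i 4 = 0 ∧ J i 5 = 0) := by
    intro i hi0 hi1 hi4 hi5
    have f02 := expand (Pi.single 0 1) (Pi.single 2 1) i
    have f12 := expand (Pi.single 1 1) (Pi.single 2 1) i
    have f46 := expand (Pi.single 4 1) (Pi.single 6 1) i
    have f56 := expand (Pi.single 5 1) (Pi.single 6 1) i
    simp only [Matrix.mulVec_single_one] at f02 f12 f46 f56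
    simp only [bra8, Matrix.col_apply, h0, h1, h4, h5, Matrix.mulVec, dotProduct,
      Fin.sum_univ_eight] at f02 f12 f46 f56
    constructor
    · apply solve (J 2 2)
      · fin_cases i <;> simp at hi0 hi1 hi4 hi5 f02 ⊢ <;> linarith
      · fin_cases i <;> simp at hi0 hi1 hi4 hi5 f12 ⊢ <;> linarith
    · apply solve (J 6 6)
      · fin_cases i <;> simp at hi0 hi1 hi4 hi5 f46 ⊢ <;> linarith
      · fin_cases i <;> simp at hi0 hi1 hi4 hi5 f56 ⊢ <;> linarith
  have c2 := hcol 2 (by decide) (by decide) (by decide) (by decide)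
  have c3 := hcol 3 (by decide) (by decide) (by decide) (by decide)
  have c6 := hcol 6 (by decide) (by decide) (by decide) (by decide)
  have c7 := hcol 7 (by decide) (by decide) (by decide) (by decide)
  refine ⟨J.submatrix ![2, 3, 6, 7] ![2, 3, 6, 7], ?_⟩
  ext i j
  fin_cases i <;> fin_cases j <;> simp [KM, h0, h1, h4, h5, c2, c3, c6, c7]

/-- The complexified bracket of u(2) ⊕ u(2). -/
def cbra8 (x y : Fin 8 → ℂ) : Fin 8 → ℂ :=
  ![x 1 * y 2 - x 2 * y 1, x 2 * y 0 - x 0 * y 2, x 0 * y 1 - x 1 * y 0, 0,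
    x 5 * y 6 - x 6 * y 5, x 6 * y 4 - x 4 * y 6, x 4 * y 5 - x 5 * y 4, 0]

lemma cbra8_add_smul (c : ℂ) (x y z w : Fin 8 → ℂ) :
    cbra8 (x + c • y) (z + c • w) =
      cbra8 x z + c • (cbra8 x w + cbra8 y z) + c ^ 2 • cbra8 y w := by
  ext i
  fin_cases i <;> simp [cbra8] <;> ring

lemma cbra8_ofReal (x y : Fin 8 → ℝ) :
    cbra8 (Complex.ofReal ∘ x) (Complex.ofReal ∘ y) = Complex.ofReal ∘ bra8 x y := by
  ext i
  fin_cases i <;> simp [cbra8, bra8]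

lemma map_ofReal_mulVec (J : Matrix (Fin 8) (Fin 8) ℝ) (x : Fin 8 → ℝ) :
    J.map Complex.ofReal *ᵥ (Complex.ofReal ∘ x) = Complex.ofReal ∘ (J *ᵥ x) := by
  ext i
  simp [Matrix.mulVec, dotProduct]

lemma map_ofReal_mulVec_star (J : Matrix (Fin 8) (Fin 8) ℝ) (x : Fin 8 → ℂ) :
    J.map Complex.ofReal *ᵥ star x = star (J.map Complex.ofReal *ᵥ x) := by
  ext i
  simp [Matrix.mulVec, dotProduct]

/-- The torsion of the complexification vanishes. -/
lemma torsion8_complex {J : Matrix (Fin 8) (Fin 8) ℝ} (hJ : torsion8 J) (X Y : Fin 8 → ℂ) :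
    cbra8 (J.map Complex.ofReal *ᵥ X) (J.map Complex.ofReal *ᵥ Y) - cbra8 X Y =
      J.map Complex.ofReal *ᵥ (cbra8 (J.map Complex.ofReal *ᵥ X) Y +
        cbra8 X (J.map Complex.ofReal *ᵥ Y)) := by
  have hreal : ∀ x y : Fin 8 → ℝ,
      cbra8 (J.map Complex.ofReal *ᵥ (Complex.ofReal ∘ x))
        (J.map Complex.ofReal *ᵥ (Complex.ofReal ∘ y)) -
        cbra8 (Complex.ofReal ∘ x) (Complex.ofReal ∘ y) =
      J.map Complex.ofReal *ᵥ
        cbra8 (J.map Complex.ofReal *ᵥ (Complex.ofReal ∘ x)) (Complex.ofReal ∘ y) +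
      J.map Complex.ofReal *ᵥ
        cbra8 (Complex.ofReal ∘ x) (J.map Complex.ofReal *ᵥ (Complex.ofReal ∘ y)) := by
    intro x y
    simp only [map_ofReal_mulVec, cbra8_ofReal]
    ext i
    have h := congrArg Complex.ofReal (congrFun (hJ x y) i)
    simp only [Pi.sub_apply, Pi.zero_apply, Complex.ofReal_sub, Complex.ofReal_zero] at h
    simp only [Pi.sub_apply, Pi.add_apply, Function.comp_apply]
    linear_combination h
  have hdecomp : ∀ Z : Fin 8 → ℂ, ∃ x y : Fin 8 → ℝ,
      Z = Complex.ofReal ∘ x + Complex.I • (Complex.ofReal ∘ y) := by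
    intro Z
    refine ⟨fun i => (Z i).re, fun i => (Z i).im, ?_⟩
    ext i
    simp only [Pi.add_apply, Pi.smul_apply, Function.comp_apply, smul_eq_mul]
    rw [mul_comm, Complex.re_add_im]
  obtain ⟨x, y, rfl⟩ := hdecomp X
  obtain ⟨z, w, rfl⟩ := hdecomp Y
  have h1 := hreal x z
  have h2 := hreal x w
  have h3 := hreal y z
  have h4 := hreal y w
  simp only [Matrix.mulVec_add, Matrix.mulVec_smul, cbra8_add_smul]
  linear_combination (norm := module) h1 + Complex.I • h2 + Complex.I • h3 + Complex.I ^ 2 • h4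

/-- The map `X ↦ (J + c) X` followed by the projection to three coordinates. -/
noncomputable def shiftProj (J : Matrix (Fin 8) (Fin 8) ℝ) (a : Fin 3 → Fin 8) (c : ℂ) :
    (Fin 8 → ℂ) →ₗ[ℂ] (Fin 3 → ℂ) :=
  LinearMap.funLeft ℂ ℂ a ∘ₗ ((J.map Complex.ofReal).mulVecLin + c • LinearMap.id)

lemma shiftProj_apply (J : Matrix (Fin 8) (Fin 8) ℝ) (a : Fin 3 → Fin 8) (c : ℂ)
    (X : Fin 8 → ℂ) (k : Fin 3) :
    shiftProj J a c X k = (J.map Complex.ofReal *ᵥ X) (a k) + c * X (a k) := rfl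

/-- If `c² = -1`, then `J + c` is a homomorphism for the bracket deformed by `J`. -/
lemma shiftProj_bracket {J : Matrix (Fin 8) (Fin 8) ℝ} (hJ : torsion8 J) {a : Fin 3 → Fin 8}
    (ha : ∀ X Y, LinearMap.funLeft ℂ ℂ a (cbra8 X Y) =
      LinearMap.funLeft ℂ ℂ a X ⨯₃ LinearMap.funLeft ℂ ℂ a Y)
    {c : ℂ} (hc : c ^ 2 = -1) (X Y : Fin 8 → ℂ) :
    shiftProj J a c (cbra8 (J.map Complex.ofReal *ᵥ X) Y +
        cbra8 X (J.map Complex.ofReal *ᵥ Y)) = shiftProj J a c X ⨯₃ shiftProj J a c Y := by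
  simp only [shiftProj, LinearMap.comp_apply, ← ha, LinearMap.add_apply, LinearMap.smul_apply,
    LinearMap.id_apply, Matrix.mulVecLin_apply, cbra8_add_smul, hc, ← torsion8_complex hJ X Y]
  congr 1
  module

lemma shiftProj_star (J : Matrix (Fin 8) (Fin 8) ℝ) (a : Fin 3 → Fin 8) (c : ℂ)
    (X : Fin 8 → ℂ) : shiftProj J a c (star X) = star (shiftProj J a (star c) X) := by
  ext k
  simp [shiftProj_apply, map_ofReal_mulVec_star]

lemma shiftProj_not_surjective {J : Matrix (Fin 8) (Fin 8) ℝ} (hJ : torsion8 J)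
    {a b : Fin 3 → Fin 8}
    (ha : ∀ X Y, LinearMap.funLeft ℂ ℂ a (cbra8 X Y) =
      LinearMap.funLeft ℂ ℂ a X ⨯₃ LinearMap.funLeft ℂ ℂ a Y)
    (hb : ∀ X Y, LinearMap.funLeft ℂ ℂ b (cbra8 X Y) =
      LinearMap.funLeft ℂ ℂ b X ⨯₃ LinearMap.funLeft ℂ ℂ b Y)
    (hab : Function.Injective (Sum.elim a b)) :
    ¬ Function.Surjective (shiftProj J a (-Complex.I)) := by
  have hm : (-Complex.I) ^ 2 = -1 := by simp
  refine not_surjective_of_conj (by simp) _ star _ (shiftProj J a Complex.I)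
    (shiftProj J b (-Complex.I)) (shiftProj J b Complex.I)
    (shiftProj_bracket hJ ha hm) (shiftProj_bracket hJ ha Complex.I_sq)
    (shiftProj_bracket hJ hb hm) (shiftProj_bracket hJ hb Complex.I_sq)
    (fun X => ?_) (fun X => ?_) (fun X => ?_) (fun X => ?_) ?_
  · simp [shiftProj_star]
  · simp [shiftProj_star]
  · simp [shiftProj_star]
  · simp [shiftProj_star]
  · rintro ⟨x, y⟩
    obtain ⟨Z, hZ⟩ := hab.surjective_comp_right (Sum.elim x y)
    have hZa : ∀ k, Z (a k) = x k := fun k => congrFun hZ (Sum.inl k)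
    have hZb : ∀ k, Z (b k) = y k := fun k => congrFun hZ (Sum.inr k)
    have hI : ∀ z : ℂ, Complex.I / 2 * (-(Complex.I * z) - Complex.I * z) = z :=
      fun z => by linear_combination -z * Complex.I_sq
    refine ⟨(Complex.I / 2) • Z, ?_⟩
    ext k
    · simp [shiftProj_apply, hZa, hI]
    · simp [shiftProj_apply, hZb, hI]

/-- An isotropic complex left eigenvector of `J` supported on an `su(2)` factor. -/
lemma exists_isotropic {J : Matrix (Fin 8) (Fin 8) ℝ} {a : Fin 3 → Fin 8}
    (hinj : Function.Injective a)
    (hcl : ∀ X Y, ∃ Z, shiftProj J a (-Complex.I) Z =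
      shiftProj J a (-Complex.I) X ⨯₃ shiftProj J a (-Complex.I) Y)
    (hns : ¬ Function.Surjective (shiftProj J a (-Complex.I))) :
    ∃ ξ : Fin 3 → ℂ, ξ ≠ 0 ∧ ξ ⬝ᵥ ξ = 0 ∧ ∀ X, ξ ⬝ᵥ shiftProj J a (-Complex.I) X = 0 := by
  set p := shiftProj J a (-Complex.I) with hp
  obtain ⟨f, hf0, hf⟩ := Submodule.exists_le_ker_of_lt_top (LinearMap.range p)
    (lt_top_iff_ne_top.mpr fun h => hns (LinearMap.range_eq_top.mp h))
  have hfξ : ∀ x, f x = (fun k => f (Pi.single k 1)) ⬝ᵥ x := by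
    intro x
    conv_lhs => rw [pi_eq_sum_univ' x, map_sum]
    simp [dotProduct, mul_comm]
  set ξ : Fin 3 → ℂ := fun k => f (Pi.single k 1) with hξ
  have hξp : ∀ X, ξ ⬝ᵥ p X = 0 := fun X => by
    rw [← hfξ]
    exact hf (LinearMap.mem_range_self p X)
  refine ⟨ξ, fun h => hf0 ?_, ?_, hξp⟩
  · ext x
    simp [hfξ, h]
  obtain ⟨X, Y, hXY⟩ : ∃ X Y, p X ⨯₃ p Y ≠ 0 := by
    by_contra! h
    have hcol : ∀ j k, p (Pi.single (a j) 1) k =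
        (J (a k) (a j) : ℂ) - Complex.I * if k = j then 1 else 0 := by
      intro j k
      rcases eq_or_ne k j with rfl | hkj
      · simp [hp, shiftProj_apply, sub_eq_add_neg]
      · simp [hp, shiftProj_apply, hinj.eq_iff, hkj]
    have h01 := h (Pi.single (a 0) 1) (Pi.single (a 1) 1)
    have h02 := h (Pi.single (a 0) 1) (Pi.single (a 2) 1)
    simp [cross_apply, hcol, Complex.ext_iff] at h01 h02
    obtain ⟨⟨-, e3⟩, -⟩ := h01
    obtain ⟨-, ⟨e1, e2⟩, -⟩ := h02
    rw [e3, eq_neg_of_add_eq_zero_left e2] at e1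
    nlinarith [sq_nonneg (J (a 0) (a 0))]
  obtain ⟨Z, hZ⟩ := hcl X Y
  have h1 : ξ ⨯₃ p Z = 0 := by
    have e1 := hξp X
    have e2 := hξp Y
    rw [hZ]
    simp only [dotProduct, Fin.sum_univ_three] at e1 e2
    ext k
    fin_cases k <;> simp [cross_apply]
    · linear_combination p X 0 * e2 - p Y 0 * e1
    · linear_combination p X 1 * e2 - p Y 1 * e1
    · linear_combination p X 2 * e2 - p Y 2 * e1
  have h2 : (ξ ⬝ᵥ ξ) • p Z = 0 := by
    have e1 := hξp Z
    simp only [cross_apply, funext_iff, Fin.forall_fin_succ] at h1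
    simp at h1
    obtain ⟨f1, f2, f3⟩ := h1
    simp only [dotProduct, Fin.sum_univ_three] at e1 ⊢
    ext k
    fin_cases k <;> simp only [Pi.smul_apply, smul_eq_mul, Pi.zero_apply, Fin.zero_eta,
      Fin.mk_one, Fin.reduceFinMk]
    · linear_combination ξ 0 * e1 - ξ 1 * f3 + ξ 2 * f2
    · linear_combination ξ 1 * e1 - ξ 2 * f1 + ξ 0 * f3
    · linear_combination ξ 2 * e1 - ξ 0 * f2 + ξ 1 * f1
  exact (smul_eq_zero.mp h2).resolve_right (hZ ▸ hXY)

lemma exists_so3_of_orthonormal {u v : Fin 3 → ℝ} (hu : u ⬝ᵥ u = 1) (hv : v ⬝ᵥ v = 1)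
    (huv : u ⬝ᵥ v = 0) : ∃ R, so3 R ∧ (∀ k, R k 0 = u k) ∧ ∀ k, R k 1 = v k := by
  have hvu : v ⬝ᵥ u = 0 := by rw [dotProduct_comm, huv]
  have hcc : (u ⨯₃ v) ⬝ᵥ (u ⨯₃ v) = 1 := by
    rw [cross_dot_cross, hu, hv, huv, hvu]; ring
  refine ⟨(Matrix.of ![u, v, u ⨯₃ v])ᵀ, ⟨?_, ?_⟩, fun _ => rfl, fun _ => rfl⟩
  · rw [Matrix.transpose_transpose, mul_eq_one_comm]
    ext i j
    rw [Matrix.mul_apply']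
    change (![u, v, u ⨯₃ v] i) ⬝ᵥ (![u, v, u ⨯₃ v] j) = _
    fin_cases i <;> fin_cases j <;>
      simp [hu, hv, huv, hvu, hcc, dot_self_cross, dot_cross_self, dotProduct_comm (u ⨯₃ v)]
  · rw [Matrix.det_transpose]
    change Matrix.det ![u, v, u ⨯₃ v] = 1
    rw [← triple_product_eq_det, triple_product_permutation, triple_product_permutation, hcc]

/-- The rows of `J` in each `su(2)` factor contain the normal form in a suitable rotated frame. -/
lemma exists_so3_rows {J : Matrix (Fin 8) (Fin 8) ℝ} (hJ : torsion8 J)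
    {a b : Fin 3 → Fin 8}
    (ha : ∀ X Y, LinearMap.funLeft ℂ ℂ a (cbra8 X Y) =
      LinearMap.funLeft ℂ ℂ a X ⨯₃ LinearMap.funLeft ℂ ℂ a Y)
    (hb : ∀ X Y, LinearMap.funLeft ℂ ℂ b (cbra8 X Y) =
      LinearMap.funLeft ℂ ℂ b X ⨯₃ LinearMap.funLeft ℂ ℂ b Y)
    (hab : Function.Injective (Sum.elim a b)) :
    ∃ R, so3 R ∧ ∀ j,
      (∑ k, R k 0 * J (a k) j = ∑ k, R k 1 * if a k = j then 1 else 0) ∧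
      (∑ k, R k 1 * J (a k) j = -∑ k, R k 0 * if a k = j then 1 else 0) := by
  obtain ⟨ξ, hξ0, hξξ, hξ⟩ := exists_isotropic (J := J) (a := a)
    (fun x y h => Sum.inl_injective (hab (by simpa using h)))
    (fun X Y => ⟨_, shiftProj_bracket hJ ha (by simp) X Y⟩)
    (shiftProj_not_surjective hJ ha hb hab)
  set x : Fin 3 → ℝ := fun k => (ξ k).re with hx
  set y : Fin 3 → ℝ := fun k => (ξ k).im with hy
  have hxx : x ⬝ᵥ x = y ⬝ᵥ y := by
    have := congrArg Complex.re hξξ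
    simp [dotProduct, Fin.sum_univ_three] at this ⊢
    linarith
  have hyx : y ⬝ᵥ x = 0 := by
    have := congrArg Complex.im hξξ
    simp [dotProduct, Fin.sum_univ_three] at this ⊢
    linarith
  have hpos : 0 < y ⬝ᵥ y := by
    refine lt_of_le_of_ne (Finset.sum_nonneg fun i _ => mul_self_nonneg _) fun h => hξ0 ?_
    have hy0 := dotProduct_self_eq_zero.mp h.symm
    have hx0 := dotProduct_self_eq_zero.mp (hxx.trans h.symm)
    ext k
    exact Complex.ext (congrFun hx0 k) (congrFun hy0 k)
  set t := (√(y ⬝ᵥ y))⁻¹ with ht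
  have ht2 : t * (t * (y ⬝ᵥ y)) = 1 := by
    rw [← mul_assoc, ht, ← mul_inv, Real.mul_self_sqrt hpos.le, inv_mul_cancel₀ hpos.ne']
  obtain ⟨R, hR, hR0, hR1⟩ := exists_so3_of_orthonormal (u := t • y) (v := t • x)
    (by simpa [smul_dotProduct, dotProduct_smul] using ht2)
    (by simpa [smul_dotProduct, dotProduct_smul, hxx] using ht2)
    (by simp [smul_dotProduct, dotProduct_smul, hyx])
  refine ⟨R, hR, fun j => ?_⟩
  have hj := hξ (Pi.single j 1)
  have hre := congrArg Complex.re hj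
  have him := congrArg Complex.im hj
  simp [dotProduct, shiftProj_apply, Fin.sum_univ_three, Pi.single_apply] at hre him
  simp only [hR0, hR1, Fin.sum_univ_three, Pi.smul_apply, smul_eq_mul, hx, hy]
  constructor
  · split_ifs at * <;> simp at * <;> linear_combination t * him
  · split_ifs at * <;> simp at * <;> linear_combination t * hre

lemma mul_row_eq {A B C : Matrix (Fin 8) (Fin 8) ℝ} (h : A * B = 1) {i k : Fin 8} {s : ℝ}
    (hi : ∀ j, (A * C) i j = s * A k j) : (A * C * B) i = s • Pi.single k 1 := by
  ext j
  rw [Matrix.mul_apply]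
  simp only [hi, mul_assoc]
  rw [← Finset.mul_sum, ← Matrix.mul_apply, h]
  simp [Matrix.one_apply, Pi.single_apply, eq_comm]

/-- A linear map J : u(2) ⊕ u(2) → u(2) ⊕ u(2) has zero torsion iff there are
R₁, R₂ ∈ SO(3), b₁, b₂ > 0 and a real 4×4 matrix M such that, for
Φ = diag(R₁,b₁,R₂,b₂), Φ⁻¹ J Φ = K(M). -/
theorem stmt17 (J : Matrix (Fin 8) (Fin 8) ℝ) :
    torsion8 J ↔
      ∃ (R₁ R₂ : Matrix (Fin 3) (Fin 3) ℝ) (b₁ b₂ : ℝ) (M : Matrix (Fin 4) (Fin 4) ℝ),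
        so3 R₁ ∧ so3 R₂ ∧ 0 < b₁ ∧ 0 < b₂ ∧
        (diag8 R₁ b₁ R₂ b₂)⁻¹ * J * diag8 R₁ b₁ R₂ b₂ = KM M := by
  have hfun : ∀ (a : Fin 3 → Fin 8) (X : Fin 8 → ℂ),
      LinearMap.funLeft ℂ ℂ a X = fun k => X (a k) := fun _ _ => rfl
  have ha : ∀ X Y, LinearMap.funLeft ℂ ℂ ![0, 1, 2] (cbra8 X Y) =
      LinearMap.funLeft ℂ ℂ ![0, 1, 2] X ⨯₃ LinearMap.funLeft ℂ ℂ ![0, 1, 2] Y := by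
    intro X Y
    ext k
    fin_cases k <;> simp [hfun, cbra8, cross_apply]
  have hb : ∀ X Y, LinearMap.funLeft ℂ ℂ ![4, 5, 6] (cbra8 X Y) =
      LinearMap.funLeft ℂ ℂ ![4, 5, 6] X ⨯₃ LinearMap.funLeft ℂ ℂ ![4, 5, 6] Y := by
    intro X Y
    ext k
    fin_cases k <;> simp [hfun, cbra8, cross_apply]
  constructor
  · intro hJ
    obtain ⟨R, hR, hRJ⟩ := exists_so3_rows hJ ha hb (by decide)
    obtain ⟨S, hS, hSJ⟩ := exists_so3_rows hJ hb ha (by decide)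
    have hinv := diag8_mul_inverse hR hS (one_ne_zero (α := ℝ)) (one_ne_zero (α := ℝ))
    have hinv' := mul_eq_one_comm.mp hinv
    have hT := torsion8_conj hJ hinv (bra8_diag8 hR hS 1 1)
    have h0 : ∀ j, (diag8 Rᵀ 1⁻¹ Sᵀ 1⁻¹ * J) 0 j =
        1 * diag8 Rᵀ 1⁻¹ Sᵀ 1⁻¹ 1 j := by
      intro j
      have h := (hRJ j).1
      simp [Fin.sum_univ_three] at h
      rw [Matrix.mul_apply, Fin.sum_univ_eight]
      simp [diag8, h]
      fin_cases j <;> simp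
    have h1 : ∀ j, (diag8 Rᵀ 1⁻¹ Sᵀ 1⁻¹ * J) 1 j =
        (-1) * diag8 Rᵀ 1⁻¹ Sᵀ 1⁻¹ 0 j := by
      intro j
      have h := (hRJ j).2
      simp [Fin.sum_univ_three] at h
      rw [Matrix.mul_apply, Fin.sum_univ_eight]
      simp [diag8, h]
      fin_cases j <;> simp
    have h4 : ∀ j, (diag8 Rᵀ 1⁻¹ Sᵀ 1⁻¹ * J) 4 j =
        1 * diag8 Rᵀ 1⁻¹ Sᵀ 1⁻¹ 5 j := by
      intro j
      have h := (hSJ j).1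
      simp [Fin.sum_univ_three] at h
      rw [Matrix.mul_apply, Fin.sum_univ_eight]
      simp [diag8, h]
      fin_cases j <;> simp
    have h5 : ∀ j, (diag8 Rᵀ 1⁻¹ Sᵀ 1⁻¹ * J) 5 j =
        (-1) * diag8 Rᵀ 1⁻¹ Sᵀ 1⁻¹ 4 j := by
      intro j
      have h := (hSJ j).2
      simp [Fin.sum_univ_three] at h
      rw [Matrix.mul_apply, Fin.sum_univ_eight]
      simp [diag8, h]
      fin_cases j <;> simp
    obtain ⟨M, hM⟩ := exists_eq_KM_of_rows hT
      ((mul_row_eq hinv' h0).trans (one_smul _ _))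
      ((mul_row_eq hinv' h1).trans (neg_one_smul _ _))
      ((mul_row_eq hinv' h4).trans (one_smul _ _))
      ((mul_row_eq hinv' h5).trans (neg_one_smul _ _))
    exact ⟨R, S, 1, 1, M, hR, hS, one_pos, one_pos, by rw [Matrix.inv_eq_left_inv hinv', hM]⟩
  · rintro ⟨R, S, b, c, M, hR, hS, hb, hc, h⟩
    have hinv := diag8_mul_inverse hR hS hb.ne' hc.ne'
    have hinv' := mul_eq_one_comm.mp hinv
    rw [Matrix.inv_eq_left_inv hinv'] at h
    have hΨ : ∀ X Y, bra8 (diag8 Rᵀ b⁻¹ Sᵀ c⁻¹ *ᵥ X) (diag8 Rᵀ b⁻¹ Sᵀ c⁻¹ *ᵥ Y) =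
        diag8 Rᵀ b⁻¹ Sᵀ c⁻¹ *ᵥ bra8 X Y :=
      bra8_diag8 (so3_transpose hR) (so3_transpose hS) _ _
    have hT := torsion8_conj (torsion8_KM M) hinv' hΨ
    rw [← h] at hT
    have hJ : diag8 R b S c * (diag8 Rᵀ b⁻¹ Sᵀ c⁻¹ * J * diag8 R b S c) *
        diag8 Rᵀ b⁻¹ Sᵀ c⁻¹ = J := by
      rw [Matrix.mul_assoc, Matrix.mul_assoc, hinv, Matrix.mul_one, ← Matrix.mul_assoc, hinv,
        Matrix.one_mul]
    rwa [hJ] at hT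
end

section
/- Let E be the space of holomorphic functions on ℂ ∖ {0} with the topology of uniform convergence on compact subsets, and let F ⊆ E be a closed ℂ-linear subspace invariant under the operator f ↦ (z ↦ z·f′(z)). Let f ∈ F and p ∈ ℤ, and let c_p = (2π)⁻¹ ∫₀^{2π} f(e^{iθ}) e^{−ipθ} dθ be the p-th Laurent coefficient of f. If c_p ≠ 0, then the function z ↦ z^p belongs to F. -/
open Filter

/-- The Euler operator, multiplying the derivative of `f` by the variable. -/
noncomputable def eulerOp (f : ℂ → ℂ) : ℂ → ℂ := fun z => z * deriv f z

lemma differentiable_comp_exp_mul {f : ℂ → ℂ} (hf : DifferentiableOn ℂ f {(0 : ℂ)}ᶜ)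
    {z : ℂ} (hz : z ≠ 0) : Differentiable ℂ fun t => f (Complex.exp t * z) := by
  intro t
  have hne : Complex.exp t * z ≠ 0 := mul_ne_zero (Complex.exp_ne_zero t) hz
  have hfz : DifferentiableAt ℂ f (Complex.exp t * z) :=
    hf.differentiableAt (isOpen_compl_singleton.mem_nhds hne)
  exact hfz.comp t (by fun_prop)

/-- The Euler operator generates the dilations `f ↦ f (exp t * ·)`. -/
lemma iteratedDeriv_comp_exp_mul {f : ℂ → ℂ}
    (hf : ∀ n, DifferentiableOn ℂ (eulerOp^[n] f) {(0 : ℂ)}ᶜ) {z : ℂ} (hz : z ≠ 0) (n : ℕ) :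
    iteratedDeriv n (fun t => f (Complex.exp t * z)) =
      fun t => (eulerOp^[n] f) (Complex.exp t * z) := by
  induction n with
  | zero => simp
  | succ n ih =>
    rw [iteratedDeriv_succ, ih]
    funext t
    have hne : Complex.exp t * z ≠ 0 := mul_ne_zero (Complex.exp_ne_zero t) hz
    have hfz : DifferentiableAt ℂ (eulerOp^[n] f) (Complex.exp t * z) :=
      (hf n).differentiableAt (isOpen_compl_singleton.mem_nhds hne)
    have hexp : HasDerivAt (fun t => Complex.exp t * z) (Complex.exp t * z) t :=
      (Complex.hasDerivAt_exp t).mul_const z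
    rw [Function.iterate_succ_apply']
    exact (hfz.hasDerivAt.comp t hexp).deriv.trans (mul_comm _ _)

/-- The Taylor expansion of `f (exp t * z)` in powers of `t`. -/
lemma hasSum_eulerOp {f : ℂ → ℂ}
    (hf : ∀ n, DifferentiableOn ℂ (eulerOp^[n] f) {(0 : ℂ)}ᶜ) {z : ℂ} (hz : z ≠ 0) (t : ℂ) :
    HasSum (fun n : ℕ => (n.factorial : ℂ)⁻¹ * t ^ n * (eulerOp^[n] f) z)
      (f (Complex.exp t * z)) := by
  have h := Complex.hasSum_taylorSeries_of_entire (differentiable_comp_exp_mul (hf 0) hz) 0 t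
  simpa [iteratedDeriv_comp_exp_mul hf hz, mul_assoc] using h

/-- Cauchy estimates make the terms of the Taylor expansion of `f (exp t * z)` decay
geometrically, uniformly for `z` in a compact set and `‖t‖ ≤ 2π`. -/
lemma exists_norm_eulerOp_le {f : ℂ → ℂ}
    (hf : ∀ n, DifferentiableOn ℂ (eulerOp^[n] f) {(0 : ℂ)}ᶜ) {K : Set ℂ} (hK : IsCompact K)
    (hK0 : K ⊆ {(0 : ℂ)}ᶜ) :
    ∃ M : ℝ, ∀ (n : ℕ), ∀ z ∈ K, ∀ t : ℂ, ‖t‖ ≤ 2 * Real.pi →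
      ‖(n.factorial : ℂ)⁻¹ * t ^ n * (eulerOp^[n] f) z‖ ≤ M * (1 / 2) ^ n := by
  have hcont : ContinuousOn (fun q : ℂ × ℂ => f (Complex.exp q.1 * q.2))
      (Metric.sphere 0 (4 * Real.pi) ×ˢ K) :=
    (hf 0).continuousOn.comp (by fun_prop)
      fun q hq => mul_ne_zero (Complex.exp_ne_zero _) (hK0 hq.2)
  obtain ⟨M, hM⟩ := ((isCompact_sphere (0 : ℂ) (4 * Real.pi)).prod hK).exists_bound_of_continuousOn
    hcont
  refine ⟨M, fun n z hz t ht => ?_⟩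
  have hπ := Real.pi_pos
  have hcauchy := Complex.norm_iteratedDeriv_le_of_forall_mem_sphere_norm_le (c := 0) n
    (by positivity : 0 < 4 * Real.pi)
    (differentiable_comp_exp_mul (f := f) (hf 0) (hK0 hz)).diffContOnCl
    fun s hs => hM (s, z) ⟨hs, hz⟩
  rw [iteratedDeriv_comp_exp_mul hf (hK0 hz)] at hcauchy
  simp only [Complex.exp_zero, one_mul] at hcauchy
  have hfac : (0 : ℝ) < n.factorial := by positivity
  calc ‖(n.factorial : ℂ)⁻¹ * t ^ n * (eulerOp^[n] f) z‖
      = (n.factorial : ℝ)⁻¹ * ‖t‖ ^ n * ‖(eulerOp^[n] f) z‖ := by simp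
    _ ≤ (n.factorial : ℝ)⁻¹ * (2 * Real.pi) ^ n * (n.factorial * M / (4 * Real.pi) ^ n) := by
        gcongr
    _ = M * (2 * Real.pi / (4 * Real.pi)) ^ n := by
        rw [div_pow]
        field_simp
    _ = M * (1 / 2) ^ n := by
        congr 2
        field_simp
        norm_num

/-- The integral of a `2πi`-periodic entire function over a vertical period segment does not
depend on the segment. -/
lemma integral_vertical_period_eq {H : ℂ → ℂ} (hH : Differentiable ℂ H)
    (hper : ∀ w, H (w + 2 * Real.pi * Complex.I) = H w) (w : ℂ) :
    ∫ θ in (0 : ℝ)..(2 * Real.pi), H (w + θ * Complex.I) =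
      ∫ θ in (0 : ℝ)..(2 * Real.pi), H (θ * Complex.I) := by
  have hshift : ∫ θ in (0 : ℝ)..(2 * Real.pi), H (w + θ * Complex.I) =
      ∫ θ in (0 : ℝ)..(2 * Real.pi), H (w.re + θ * Complex.I) := by
    have hp : Function.Periodic (fun θ : ℝ => H (w.re + θ * Complex.I)) (2 * Real.pi) := by
      intro θ
      simp only
      rw [← hper (w.re + θ * Complex.I)]
      congr 1
      push_cast
      ring
    have hadd := hp.intervalIntegral_add_eq w.im 0
    have hsub := intervalIntegral.integral_comp_add_left (a := 0) (b := 2 * Real.pi)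
      (fun θ : ℝ => H (w.re + θ * Complex.I)) w.im
    rw [add_zero, hadd, zero_add] at hsub
    rw [← hsub]
    refine intervalIntegral.integral_congr fun θ _ => ?_
    congr 1
    conv_lhs => rw [← Complex.re_add_im w]
    push_cast
    ring
  have hrect := Complex.integral_boundary_rect_eq_zero_of_differentiableOn H 0
    (w.re + (2 * Real.pi : ℝ) * Complex.I) hH.differentiableOn
  have hhor : ∀ x : ℝ, H (x + ((2 * Real.pi : ℝ) : ℂ) * Complex.I) = H x := by
    intro x
    rw [← hper x]
    push_cast
    rfl
  simp only [Complex.add_re, Complex.add_im, Complex.re_ofReal_mul, Complex.im_ofReal_mul,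
    Complex.ofReal_re, Complex.ofReal_im, Complex.I_re, Complex.I_im, Complex.zero_re,
    Complex.zero_im, mul_zero, mul_one, add_zero, zero_add, hhor, Complex.ofReal_zero, zero_mul,
    sub_self, ← smul_sub] at hrect
  rw [hshift]
  exact sub_eq_zero.1 ((smul_eq_zero.1 hrect).resolve_left Complex.I_ne_zero)

/-- The rotational Fourier coefficients of `f` are its Laurent monomials. -/
lemma integral_rotation_eq {f : ℂ → ℂ} (hf : DifferentiableOn ℂ f {(0 : ℂ)}ᶜ) (p : ℤ)
    {z : ℂ} (hz : z ≠ 0) :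
    ∫ θ in (0 : ℝ)..(2 * Real.pi),
        Complex.exp (-(p : ℂ) * θ * Complex.I) * f (Complex.exp (θ * Complex.I) * z) =
      (∫ θ in (0 : ℝ)..(2 * Real.pi),
        f (Complex.exp (θ * Complex.I)) * Complex.exp (-(p : ℂ) * θ * Complex.I)) * z ^ p := by
  have hH : Differentiable ℂ fun w => f (Complex.exp w) * Complex.exp (-(p : ℂ) * w) := by
    have h := differentiable_comp_exp_mul hf one_ne_zero
    simp only [mul_one] at h
    exact h.mul (by fun_prop)
  have hper : ∀ w : ℂ, f (Complex.exp (w + 2 * Real.pi * Complex.I)) *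
      Complex.exp (-(p : ℂ) * (w + 2 * Real.pi * Complex.I)) =
      f (Complex.exp w) * Complex.exp (-(p : ℂ) * w) := by
    intro w
    rw [Complex.exp_periodic w]
    congr 1
    rw [Complex.exp_eq_exp_iff_exists_int]
    exact ⟨-p, by push_cast; ring⟩
  have key := integral_vertical_period_eq hH hper (Complex.log z)
  have hzp : z ^ p = Complex.exp (p * Complex.log z) := by
    rw [Complex.exp_int_mul, Complex.exp_log hz]
  simp only [← mul_assoc] at key
  rw [← key, ← intervalIntegral.integral_mul_const]
  refine intervalIntegral.integral_congr fun θ _ => ?_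
  rw [hzp, mul_assoc (f _), ← Complex.exp_add, Complex.exp_add (Complex.log z), Complex.exp_log hz,
    mul_comm z, mul_comm (Complex.exp _) (f _)]
  congr 2
  ring

/-- Let F be a closed ℂ-linear subspace of the space of holomorphic functions on ℂ ∖ {0}
(with the topology of uniform convergence on compact subsets, here expressed through
closedness under locally uniform limits on ℂ ∖ {0}, which is equivalent in this metrizable
setting), invariant under the operator f ↦ (z ↦ z·f′(z)). If f ∈ F and its p-th Laurent
coefficient c_p = (2π)⁻¹ ∫₀^{2π} f(e^{iθ}) e^{−ipθ} dθ is nonzero, then z ↦ z^p belongs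
to F (as a function on ℂ ∖ {0}). -/
theorem stmt19 (F : Set (ℂ → ℂ))
    (hdiff : ∀ f ∈ F, DifferentiableOn ℂ f {(0 : ℂ)}ᶜ)
    (hzero : (0 : ℂ → ℂ) ∈ F)
    (hadd : ∀ f ∈ F, ∀ g ∈ F, f + g ∈ F)
    (hsmul : ∀ (c : ℂ), ∀ f ∈ F, c • f ∈ F)
    (hinv : ∀ f ∈ F, (fun z => z * deriv f z) ∈ F)
    (hclosed : ∀ (φ : ℕ → ℂ → ℂ) (g : ℂ → ℂ), (∀ n, φ n ∈ F) →
      DifferentiableOn ℂ g {(0 : ℂ)}ᶜ →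
      TendstoLocallyUniformlyOn φ g atTop {(0 : ℂ)}ᶜ → g ∈ F)
    (f : ℂ → ℂ) (hf : f ∈ F) (p : ℤ)
    (hc : ((2 * Real.pi : ℝ) : ℂ)⁻¹ * ∫ θ in (0 : ℝ)..(2 * Real.pi),
        f (Complex.exp (θ * Complex.I)) * Complex.exp (-(p : ℂ) * θ * Complex.I) ≠ 0) :
    ∃ g ∈ F, ∀ z : ℂ, z ≠ 0 → g z = z ^ p := by
  have hmem : ∀ n, eulerOp^[n] f ∈ F := by
    intro n
    induction n with
    | zero => exact hf
    | succ n ih =>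
      rw [Function.iterate_succ_apply']
      exact hinv _ ih
  have hd : ∀ n, DifferentiableOn ℂ (eulerOp^[n] f) {(0 : ℂ)}ᶜ := fun n => hdiff _ (hmem n)
  set c := ∫ θ in (0 : ℝ)..(2 * Real.pi),
    f (Complex.exp (θ * Complex.I)) * Complex.exp (-(p : ℂ) * θ * Complex.I) with hcdef
  have hc0 : c ≠ 0 := right_ne_zero_of_mul hc
  let integrand : ℕ → ℂ → ℝ → ℂ := fun n z θ => Complex.exp (-(p : ℂ) * θ * Complex.I) *
    ((n.factorial : ℂ)⁻¹ * (θ * Complex.I) ^ n * (eulerOp^[n] f) z)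
  let term : ℕ → ℂ → ℂ := fun n z => ∫ θ in (0 : ℝ)..(2 * Real.pi), integrand n z θ
  have hπ : (0 : ℝ) ≤ 2 * Real.pi := by positivity
  have hbound : ∀ K : Set ℂ, K ⊆ {(0 : ℂ)}ᶜ → IsCompact K → ∃ M : ℝ, ∀ n, ∀ z ∈ K,
      ∀ θ ∈ Set.uIoc 0 (2 * Real.pi), ‖integrand n z θ‖ ≤ M * (1 / 2) ^ n := by
    intro K hK0 hK
    obtain ⟨M, hM⟩ := exists_norm_eulerOp_le hd hK hK0
    refine ⟨M, fun n z hz θ hθ => ?_⟩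
    rw [Set.uIoc_of_le hπ] at hθ
    have hexp : ‖Complex.exp (-(p : ℂ) * θ * Complex.I)‖ = 1 := by
      have := Complex.norm_exp_ofReal_mul_I (-(p : ℝ) * θ)
      push_cast at this
      exact this
    have hnorm : ‖(θ : ℂ) * Complex.I‖ ≤ 2 * Real.pi := by
      simpa [abs_of_pos hθ.1] using hθ.2
    simp only [integrand]
    rw [norm_mul, hexp, one_mul]
    exact hM n z hz _ hnorm
  have hgeom : ∀ M : ℝ, Summable fun n : ℕ => M * (1 / 2 : ℝ) ^ n :=
    fun M => summable_geometric_two.mul_left M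
  have hsum : ∀ z : ℂ, z ≠ 0 → HasSum (fun n => term n z) (c * z ^ p) := by
    intro z hz
    obtain ⟨M, hM⟩ := hbound {z} (by simpa using hz.symm) isCompact_singleton
    rw [hcdef, ← integral_rotation_eq (hdiff f hf) p hz]
    refine intervalIntegral.hasSum_integral_of_dominated_convergence
      (fun n _ => M * (1 / 2) ^ n) (fun n => ?_)
      (fun n => Eventually.of_forall fun θ hθ => hM n z rfl θ hθ)
      (Eventually.of_forall fun _ _ => hgeom M) intervalIntegrable_const
      (Eventually.of_forall fun θ _ => (hasSum_eulerOp hd hz _).mul_left _)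
    exact Continuous.aestronglyMeasurable (by fun_prop)
  have hterm : ∀ n, term n ∈ F := by
    intro n
    convert hsmul (∫ θ in (0 : ℝ)..(2 * Real.pi), Complex.exp (-(p : ℂ) * θ * Complex.I) *
      ((n.factorial : ℂ)⁻¹ * (θ * Complex.I) ^ n)) _ (hmem n) using 1
    funext z
    simp only [term, integrand, Pi.smul_apply, smul_eq_mul,
      ← intervalIntegral.integral_mul_const, mul_assoc]
  have hpartial : ∀ N, (fun z => ∑ n ∈ Finset.range N, term n z) ∈ F := by
    intro N
    induction N with
    | zero => simpa using! hzero
    | succ N ih =>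
      simp only [Finset.sum_range_succ]
      exact hadd _ ih _ (hterm N)
  have hlim : (fun z => c * z ^ p) ∈ F := by
    refine hclosed _ _ hpartial (fun z hz => ?_) ?_
    · exact ((differentiableAt_zpow.2 (Or.inl hz)).const_mul c).differentiableWithinAt
    · rw [tendstoLocallyUniformlyOn_iff_forall_isCompact isOpen_compl_singleton]
      intro K hK0 hK
      obtain ⟨M, hM⟩ := hbound K hK0 hK
      refine (tendstoUniformlyOn_tsum_nat ((hgeom M).mul_right |2 * Real.pi - 0|)
        fun n z hz => intervalIntegral.norm_integral_le_of_norm_le_const (hM n z hz)).congr_right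
          fun z hz => (hsum z (hK0 hz)).tsum_eq
  refine ⟨_, hsmul c⁻¹ _ hlim, fun z _ => ?_⟩
  simp [hc0]
end
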